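/- Let n ∈ {-1} ∪ ω and suppose κ ∉ I(Π^1_n(κ)). Then κ is subtle and Π^1_{n+2}-indescribable, the ideal generated by NSub_κ ∪ Π^1_{n+2}(κ) is a nontrivial normal ideal on κ, and I(Π^1_n(κ)) equals the ideal generated by NSub_κ ∪ Π^1_{n+2}(κ). Conversely, if κ is subtle and Π^1_{n+2}-indescribable and the ideal generated by NSub_κ ∪ Π^1_{n+2}(κ) is a nontrivial normal ideal equal to I(Π^1_n(κ)), then κ ∉ I(Π^1_n(κ)). -/

import Mathlib

namespace LCI


/-- `κ` is (the initial ordinal of) a regular uncountable cardinal. -/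
def RegUncountable (kappa : Ordinal.{0}) : Prop :=
  Ordinal.omega0 < kappa ∧ kappa.cof.ord = kappa

/-- `C` is a club (closed unbounded) subset of the ordinal `κ`. -/
def IsClubIn (C : Set Ordinal.{0}) (kappa : Ordinal.{0}) : Prop :=
  C ⊆ Set.Iio kappa ∧
  (∀ alpha < kappa, ∃ beta ∈ C, alpha < beta) ∧
  ∀ beta < kappa, beta ≠ 0 →
    (∀ gamma < beta, ∃ delta ∈ C, gamma < delta ∧ delta < beta) → beta ∈ C

/-- `S` is a stationary subset of the ordinal `κ`. -/
def IsStationaryIn (S : Set Ordinal.{0}) (kappa : Ordinal.{0}) : Prop :=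
  S ⊆ Set.Iio kappa ∧ ∀ C, IsClubIn C kappa → (S ∩ C).Nonempty

/-- `H` is homogeneous for the list `L` (where `L α ⊆ α` on the relevant domain):
whenever `α < β` are both in `H`, `L α = L β ∩ α`. -/
def Homog (L : Ordinal.{0} → Set Ordinal.{0}) (H : Set Ordinal.{0}) : Prop :=
  ∀ alpha ∈ H, ∀ beta ∈ H, alpha < beta → L alpha = L beta ∩ Set.Iio alpha

/-- `S ⊆ κ` is a subtle subset of `κ`: for every `S`-list `L` (i.e. `L α ⊆ α` for
`α ∈ S`) and every club `C ⊆ κ` there are `α < β` in `S ∩ C` with `L α = L β ∩ α`. -/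
def IsSubtleIn (S : Set Ordinal.{0}) (kappa : Ordinal.{0}) : Prop :=
  S ⊆ Set.Iio kappa ∧
  ∀ L : Ordinal.{0} → Set Ordinal.{0}, (∀ alpha ∈ S, L alpha ⊆ Set.Iio alpha) →
    ∀ C, IsClubIn C kappa →
      ∃ alpha ∈ S ∩ C, ∃ beta ∈ S ∩ C, alpha < beta ∧ L alpha = L beta ∩ Set.Iio alpha

/-- `I` is an ideal on the ordinal `κ`: a collection of subsets of `κ` containing `∅`,
closed under subsets and finite unions. -/
def IsIdealOn (kappa : Ordinal.{0}) (I : Set (Set Ordinal.{0})) : Prop :=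
  (∀ X ∈ I, X ⊆ Set.Iio kappa) ∧ (∅ ∈ I) ∧
  (∀ X ∈ I, ∀ Y, Y ⊆ X → Y ∈ I) ∧
  (∀ X ∈ I, ∀ Y ∈ I, X ∪ Y ∈ I)

/-- The diagonal union `∇_{α<κ} X α = {β < κ : β ∈ ⋃_{α<β} X α}`. -/
def diagUnion (kappa : Ordinal.{0}) (X : Ordinal.{0} → Set Ordinal.{0}) : Set Ordinal.{0} :=
  {beta | beta < kappa ∧ ∃ alpha < beta, beta ∈ X alpha}

/-- `I` is a normal ideal on `κ`: an ideal closed under diagonal unions. -/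
def IsNormalIdealOn (kappa : Ordinal.{0}) (I : Set (Set Ordinal.{0})) : Prop :=
  IsIdealOn kappa I ∧
  ∀ X : Ordinal.{0} → Set Ordinal.{0}, (∀ alpha < kappa, X alpha ∈ I) → diagUnion kappa X ∈ I

/-- The subtle ideal on `κ`: the collection of non-subtle subsets of `κ`. -/
def NSub (kappa : Ordinal.{0}) : Set (Set Ordinal.{0}) :=
  {X | X ⊆ Set.Iio kappa ∧ ¬ IsSubtleIn X kappa}

/-- Second-order formulas over a structure `(M, ∈, A)` where `M` is a set of sets:
de Bruijn indexed first-order variables and second-order (subset) variables,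
a binary membership relation, and a unary predicate for `A`. -/
inductive SOForm : Type where
  | mem : ℕ → ℕ → SOForm
  | app : ℕ → ℕ → SOForm
  | inA : ℕ → SOForm
  | not : SOForm → SOForm
  | and : SOForm → SOForm → SOForm
  | fall : SOForm → SOForm
  | sall : SOForm → SOForm

/-- Prepend a value to a valuation (de Bruijn style). -/
def consVal {alpha : Type 1} (x : alpha) (v : ℕ → alpha) : ℕ → alpha
  | 0 => x
  | n + 1 => v n

/-- Satisfaction of a second-order formula in the structure `(M, ∈, A)`,
relative to first- and second-order valuations; first-order quantifiers range
over `M` and second-order quantifiers range over subsets of `M`. -/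
def SOSat (M A : Set ZFSet.{0}) : SOForm → (ℕ → ZFSet.{0}) → (ℕ → Set ZFSet.{0}) → Prop
  | .mem i j, v, _ => v i ∈ v j
  | .app i j, v, w => v j ∈ w i
  | .inA i, v, _ => v i ∈ A
  | .not phi, v, w => ¬ SOSat M A phi v w
  | .and phi psi, v, w => SOSat M A phi v w ∧ SOSat M A psi v w
  | .fall phi, v, w => ∀ x ∈ M, SOSat M A phi (consVal x v) w
  | .sall phi, v, w => ∀ P : Set ZFSet.{0}, P ⊆ M → SOSat M A phi v (consVal P w)

/-- A formula is first-order if it contains no second-order quantifier. -/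
def SOForm.FO : SOForm → Prop
  | .not phi => phi.FO
  | .and phi psi => phi.FO ∧ psi.FO
  | .fall phi => phi.FO
  | .sall _ => False
  | _ => True

mutual
  /-- `IsPiForm n φ` : `φ` is a `Π¹ₙ` formula. -/
  inductive IsPiForm : ℕ → SOForm → Prop where
    | fo {phi : SOForm} : phi.FO → IsPiForm 0 phi
    | up {n : ℕ} {phi : SOForm} : IsSigmaForm n phi → IsPiForm (n + 1) phi
    | all {n : ℕ} {phi : SOForm} : IsPiForm (n + 1) phi → IsPiForm (n + 1) (SOForm.sall phi)
  /-- `IsSigmaForm n φ` : `φ` is a `Σ¹ₙ` formula. -/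
  inductive IsSigmaForm : ℕ → SOForm → Prop where
    | fo {phi : SOForm} : phi.FO → IsSigmaForm 0 phi
    | up {n : ℕ} {phi : SOForm} : IsPiForm n phi → IsSigmaForm (n + 1) phi
    | ex {n : ℕ} {phi : SOForm} : IsSigmaForm (n + 1) phi →
        IsSigmaForm (n + 1) (SOForm.not (SOForm.sall (SOForm.not phi)))
end

/-- Satisfaction of a sentence: satisfaction under the default valuations. -/
def SOSatS (M A : Set ZFSet.{0}) (phi : SOForm) : Prop :=
  SOSat M A phi (fun _ => ∅) (fun _ => ∅)

/-- The rank-initial segment `V_α` of the set-theoretic universe. -/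
def Vrank (alpha : Ordinal.{0}) : Set ZFSet.{0} := {x | ZFSet.rank x < alpha}

/-- `X ⊆ κ` is a `Π¹ₙ`-indescribable subset of `κ` : for every `A ⊆ V_κ` and every
`Π¹ₙ` sentence `φ`, if `(V_κ, ∈, A) ⊨ φ` then `(V_ξ, ∈, A ∩ V_ξ) ⊨ φ` for some `ξ ∈ X`. -/
def PiIndesc (n : ℕ) (X : Set Ordinal.{0}) (kappa : Ordinal.{0}) : Prop :=
  X ⊆ Set.Iio kappa ∧
  ∀ A : Set ZFSet.{0}, A ⊆ Vrank kappa → ∀ phi : SOForm, IsPiForm n phi →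
    SOSatS (Vrank kappa) A phi → ∃ xi ∈ X, SOSatS (Vrank xi) (A ∩ Vrank xi) phi

/-- `X` is a `Π¹ₙ`-indescribable subset of `κ` for `n ∈ {-1} ∪ ω` : for `n ≥ 0` this is
`Π¹ₙ`-indescribability, and by convention for `n = -1` it means `X ⊆ κ` has cardinality `κ`
(i.e. `X ∈ ([κ]^{<κ})⁺`). -/
def PiPos (n : ℤ) (X : Set Ordinal.{0}) (kappa : Ordinal.{0}) : Prop :=
  match n with
  | Int.ofNat m => PiIndesc m X kappa
  | Int.negSucc _ => X ⊆ Set.Iio kappa ∧ Cardinal.mk ↥X = Cardinal.lift.{1} kappa.card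

/-- The ideal `Π¹ₙ(κ)` of non-`Π¹ₙ`-indescribable subsets of `κ`
(with the convention `Π¹₋₁(κ) = [κ]^{<κ}`). -/
def PiIdealZ (n : ℤ) (kappa : Ordinal.{0}) : Set (Set Ordinal.{0}) :=
  {X | X ⊆ Set.Iio kappa ∧ ¬ PiPos n X kappa}

/-- `S ∈ 𝓘(I)⁺` for the ideal with positive sets `P` : every `S`-list has a
homogeneous subset `H ⊆ S` satisfying `P`. -/
def IneffPos (kappa : Ordinal.{0}) (P : Set Ordinal.{0} → Prop) (S : Set Ordinal.{0}) : Prop :=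
  S ⊆ Set.Iio kappa ∧
  ∀ L : Ordinal.{0} → Set Ordinal.{0}, (∀ alpha ∈ S, L alpha ⊆ Set.Iio alpha) →
    ∃ H, H ⊆ S ∧ P H ∧ Homog L H

/-- The ideal generated by `J ∪ K` : all sets of the form `A ∪ B` with `A ∈ J`, `B ∈ K`. -/
def genIdeal (J K : Set (Set Ordinal.{0})) : Set (Set Ordinal.{0}) :=
  {X | ∃ A ∈ J, ∃ B ∈ K, X = A ∪ B}

/-- The ideal `𝓘(Π¹ₙ(κ))` on `κ` (for `n ∈ {-1} ∪ ω`). -/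
def IneffIdeal (n : ℤ) (kappa : Ordinal.{0}) : Set (Set Ordinal.{0}) :=
  {X | X ⊆ Set.Iio kappa ∧ ¬ IneffPos kappa (fun H => PiPos n H kappa) X}

/-! ### Clubs of closure points -/

section Clubs

variable {kappa : Ordinal.{0}}

theorem RegUncountable.cof_eq (h : RegUncountable kappa) : kappa.cof = kappa.card := by
  have := congrArg Ordinal.card h.2
  rwa [Cardinal.card_ord] at this

theorem RegUncountable.ord_card (h : RegUncountable kappa) : kappa.card.ord = kappa := by
  rw [← h.cof_eq, h.2]

theorem RegUncountable.pos (h : RegUncountable kappa) : 0 < kappa :=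
  Ordinal.omega0_pos.trans h.1

theorem RegUncountable.aleph0_lt (h : RegUncountable kappa) : Cardinal.aleph0 < kappa.card := by
  have := h.1
  rwa [← h.ord_card, ← Cardinal.ord_aleph0, Cardinal.ord_lt_ord] at this

theorem RegUncountable.isSuccLimit (h : RegUncountable kappa) : Order.IsSuccLimit kappa := by
  rw [← h.ord_card]
  exact Cardinal.isSuccLimit_ord h.aleph0_lt.le

theorem RegUncountable.succ_lt (h : RegUncountable kappa) {a : Ordinal.{0}} (ha : a < kappa) :
    Order.succ a < kappa := h.isSuccLimit.succ_lt ha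

theorem RegUncountable.card_lt (h : RegUncountable kappa) {a : Ordinal.{0}} (ha : a < kappa) :
    a.card < kappa.card := by
  rwa [← Cardinal.lt_ord, h.ord_card]

theorem RegUncountable.exists_bound (h : RegUncountable kappa) {s : Set Ordinal.{0}}
    (hs : Cardinal.mk s < Cardinal.lift.{1} kappa.card) (hlt : ∀ a ∈ s, a < kappa) :
    ∃ d < kappa, ∀ a ∈ s, a < d := by
  refine ⟨Order.succ (sSup s), h.succ_lt (Ordinal.sSup_lt_of_lt_cof ?_ hlt), fun a ha =>
    Order.lt_succ_of_le (le_csSup ⟨kappa, fun x hx => (hlt x hx).le⟩ ha)⟩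
  rwa [← Ordinal.lift_cof, h.cof_eq]

theorem RegUncountable.exists_bound_range (h : RegUncountable kappa) {iota : Type 1}
    (hs : Cardinal.mk iota < Cardinal.lift.{1} kappa.card) (g : iota → Ordinal.{0})
    (hlt : ∀ i, g i < kappa) :
    ∃ d < kappa, ∀ i, g i < d := by
  obtain ⟨d, hd, hb⟩ := h.exists_bound (s := Set.range g) (Cardinal.mk_range_le.trans_lt hs)
    (by rintro _ ⟨i, rfl⟩; exact hlt i)
  exact ⟨d, hd, fun i => hb _ ⟨i, rfl⟩⟩

theorem RegUncountable.exists_bound_countable (h : RegUncountable kappa) {iota : Type*}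
    [Countable iota] (g : iota → Ordinal.{0}) (hlt : ∀ i, g i < kappa) :
    ∃ d < kappa, ∀ i, g i < d := by
  obtain ⟨d, hd, hb⟩ := h.exists_bound (s := Set.range g)
    ((Set.countable_range g).le_aleph0.trans_lt (Cardinal.aleph0_lt_lift.2 h.aleph0_lt))
    (by rintro _ ⟨i, rfl⟩; exact hlt i)
  exact ⟨d, hd, fun i => hb _ ⟨i, rfl⟩⟩

theorem RegUncountable.exists_bound_Iio (h : RegUncountable kappa) {b : Ordinal.{0}}
    (hb : b < kappa) (g : Ordinal.{0} → Ordinal.{0}) (hlt : ∀ i < b, g i < kappa) :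
    ∃ d < kappa, ∀ i < b, g i < d := by
  obtain ⟨d, hd, hb⟩ := h.exists_bound_range (iota := Set.Iio b) (by
    rw [Cardinal.mk_Iio_ordinal, Cardinal.lift_lt]
    exact h.card_lt hb) (fun i => g i) (fun i => hlt i i.2)
  exact ⟨d, hd, fun i hi => hb ⟨i, hi⟩⟩

/-- The nonzero closure points below `kappa` of a function on ordinals. -/
def closurePts (f : Ordinal.{0} → Ordinal.{0}) (kappa : Ordinal.{0}) : Set Ordinal.{0} :=
  {xi | 0 < xi ∧ xi < kappa ∧ ∀ gamma < xi, f gamma < xi}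

theorem isClubIn_closurePts (h : RegUncountable kappa) {f : Ordinal.{0} → Ordinal.{0}}
    (hf : ∀ a < kappa, f a < kappa) : IsClubIn (closurePts f kappa) kappa := by
  refine ⟨fun x hx => hx.2.1, fun a ha => ?_, fun b hb hb0 hlim => ⟨?_, hb, fun g hg => ?_⟩⟩
  · have step : ∀ d : Ordinal.{0}, ∃ e, d < kappa → e < kappa ∧ d < e ∧ ∀ g < d, f g < e := by
      intro d
      by_cases hd : d < kappa
      · obtain ⟨e, he, hb⟩ := h.exists_bound_Iio hd f (fun i hi => hf i (hi.trans hd))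
        exact ⟨max e (Order.succ d), fun _ => ⟨max_lt he (h.succ_lt hd),
          (Order.lt_succ d).trans_le (le_max_right _ _), fun g hg =>
          (hb g hg).trans_le (le_max_left _ _)⟩⟩
      · exact ⟨0, fun h => absurd h hd⟩
    choose e he using step
    let x : ℕ → Ordinal.{0} := fun k => e^[k] (Order.succ a)
    have hx1 : ∀ k, x (k + 1) = e (x k) := fun k => Function.iterate_succ_apply' e k _
    have hx : ∀ k, x k < kappa := by
      intro k
      induction k with
      | zero => exact h.succ_lt ha
      | succ k ih => rw [hx1]; exact (he _ ih).1
    obtain ⟨d, hd, hb⟩ := h.exists_bound_countable x hx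
    have hbdd : BddAbove (Set.range x) := ⟨d, by rintro _ ⟨k, rfl⟩; exact (hb k).le⟩
    have hle : ∀ k, x k ≤ ⨆ k, x k := fun k => le_ciSup hbdd k
    have ha' : a < ⨆ k, x k := (Order.lt_succ a).trans_le (hle 0)
    refine ⟨⨆ k, x k, ⟨(zero_le (a := a)).trans_lt ha', (ciSup_le fun k => (hb k).le).trans_lt hd,
      fun g hg => ?_⟩, ha'⟩
    obtain ⟨k, hk⟩ := exists_lt_of_lt_ciSup hg
    exact ((he _ (hx k)).2.2 g hk).trans_le ((hx1 k).symm.le.trans (hle _))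
  · exact pos_iff_ne_zero.2 hb0
  · obtain ⟨d, hd, hgd, hdb⟩ := hlim g hg
    exact (hd.2.2 g hgd).trans hdb

theorem exists_closurePts_subset {C : Set Ordinal.{0}} (hC : IsClubIn C kappa) :
    ∃ f : Ordinal.{0} → Ordinal.{0}, (∀ a < kappa, f a < kappa) ∧ closurePts f kappa ⊆ C := by
  have : ∀ a, ∃ b, a < kappa → b ∈ C ∧ a < b := fun a => by
    by_cases ha : a < kappa
    · obtain ⟨b, hb, hab⟩ := hC.2.1 a ha
      exact ⟨b, fun _ => ⟨hb, hab⟩⟩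
    · exact ⟨0, fun h => absurd h ha⟩
  choose f hf using this
  refine ⟨f, fun a ha => hC.1 (hf a ha).1, fun x hx => hC.2.2 x hx.2.1 hx.1.ne' fun g hg => ?_⟩
  obtain ⟨h1, h2⟩ := hf g (hg.trans hx.2.1)
  exact ⟨f g, h1, h2, hx.2.2 g hg⟩

theorem closurePts_anti {f g : Ordinal.{0} → Ordinal.{0}} (h : ∀ a, f a ≤ g a) :
    closurePts g kappa ⊆ closurePts f kappa :=
  fun _ hx => ⟨hx.1, hx.2.1, fun a ha => (h a).trans_lt (hx.2.2 a ha)⟩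

theorem IsClubIn.exists_inter (h : RegUncountable kappa) {C D : Set Ordinal.{0}}
    (hC : IsClubIn C kappa) (hD : IsClubIn D kappa) :
    ∃ E, IsClubIn E kappa ∧ E ⊆ C ∩ D := by
  obtain ⟨f, hf, hfC⟩ := exists_closurePts_subset hC
  obtain ⟨g, hg, hgD⟩ := exists_closurePts_subset hD
  exact ⟨closurePts (fun a => max (f a) (g a)) kappa,
    isClubIn_closurePts h fun a ha => max_lt (hf a ha) (hg a ha),
    fun x hx => ⟨hfC (closurePts_anti (fun a => le_max_left _ _) hx),
      hgD (closurePts_anti (fun a => le_max_right _ _) hx)⟩⟩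

/-- Being unbounded in the ordinal `kappa`. -/
def UnbddIn (C : Set Ordinal.{0}) (kappa : Ordinal.{0}) : Prop :=
  ∀ gamma < kappa, ∃ delta ∈ C, gamma < delta ∧ delta < kappa

theorem mk_eq_iff_unbddIn (h : RegUncountable kappa) {H : Set Ordinal.{0}}
    (hH : H ⊆ Set.Iio kappa) :
    Cardinal.mk H = Cardinal.lift.{1} kappa.card ↔ UnbddIn H kappa := by
  constructor
  · intro hc g hg
    by_contra! hcon
    have : H ⊆ Set.Iio (Order.succ g) := fun x hx => by
      by_contra hx'
      exact absurd (hH hx) (not_lt.2 (hcon x hx (Order.succ_le_iff.1 (not_lt.1 hx'))))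
    have := Cardinal.mk_le_mk_of_subset this
    rw [hc, Cardinal.mk_Iio_ordinal, Cardinal.lift_le] at this
    exact absurd (h.card_lt (h.succ_lt hg)) (not_lt.2 this)
  · intro hu
    refine le_antisymm ?_ (not_lt.1 fun hlt => ?_)
    · rw [← Cardinal.mk_Iio_ordinal]
      exact Cardinal.mk_le_mk_of_subset hH
    · obtain ⟨d, hd, hb⟩ := h.exists_bound hlt hH
      obtain ⟨e, he, hde, -⟩ := hu d hd
      exact absurd (hb e he) hde.asymm

end Clubs

/-! ### Second-order formulas -/

namespace SOForm

/-- Disjunction. -/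
def or (phi psi : SOForm) : SOForm := .not (.and (.not phi) (.not psi))

/-- Implication. -/
def imp (phi psi : SOForm) : SOForm := .not (.and phi (.not psi))

/-- Equivalence. -/
def iff (phi psi : SOForm) : SOForm := .and (phi.imp psi) (psi.imp phi)

/-- First-order existential quantification. -/
def fex (phi : SOForm) : SOForm := .not (.fall (.not phi))

/-- The extension of a renaming under a second-order quantifier. -/
def liftRen (f : ℕ → ℕ) : ℕ → ℕ
  | 0 => 0
  | n + 1 => f n + 1

/-- Renaming of second-order variables. -/
def ren : (ℕ → ℕ) → SOForm → SOForm
  | _, .mem i j => .mem i j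
  | f, .app i j => .app (f i) j
  | _, .inA i => .inA i
  | f, .not phi => .not (phi.ren f)
  | f, .and phi psi => .and (phi.ren f) (psi.ren f)
  | f, .fall phi => .fall (phi.ren f)
  | f, .sall phi => .sall (phi.ren (liftRen f))

theorem FO.ren {phi : SOForm} (h : phi.FO) (f : ℕ → ℕ) : (phi.ren f).FO := by
  induction phi generalizing f with
  | mem | app | inA => trivial
  | not phi ih => exact ih h f
  | and phi psi ih1 ih2 => exact ⟨ih1 h.1 f, ih2 h.2 f⟩
  | fall phi ih => exact ih h f
  | sall phi ih => exact h.elim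

@[simp] theorem FO_mem (i j : ℕ) : (SOForm.mem i j).FO := trivial
@[simp] theorem FO_app (i j : ℕ) : (SOForm.app i j).FO := trivial
@[simp] theorem FO_inA (i : ℕ) : (SOForm.inA i).FO := trivial
@[simp] theorem FO_not (phi : SOForm) : (SOForm.not phi).FO ↔ phi.FO := Iff.rfl
@[simp] theorem FO_and (phi psi : SOForm) : (SOForm.and phi psi).FO ↔ phi.FO ∧ psi.FO := Iff.rfl
@[simp] theorem FO_fall (phi : SOForm) : (SOForm.fall phi).FO ↔ phi.FO := Iff.rfl
@[simp] theorem FO_or (phi psi : SOForm) : (SOForm.or phi psi).FO ↔ phi.FO ∧ psi.FO := Iff.rfl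
@[simp] theorem FO_imp (phi psi : SOForm) : (SOForm.imp phi psi).FO ↔ phi.FO ∧ psi.FO := Iff.rfl
@[simp] theorem FO_iff (phi psi : SOForm) : (SOForm.iff phi psi).FO ↔ phi.FO ∧ psi.FO := by
  simp [SOForm.iff, and_comm]
@[simp] theorem FO_fex (phi : SOForm) : (SOForm.fex phi).FO ↔ phi.FO := Iff.rfl

end SOForm

section Sat

variable (M A : Set ZFSet.{0}) (v : ℕ → ZFSet.{0}) (w : ℕ → Set ZFSet.{0})

@[simp] theorem sat_mem (i j : ℕ) : SOSat M A (.mem i j) v w ↔ v i ∈ v j := Iff.rfl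
@[simp] theorem sat_app (i j : ℕ) : SOSat M A (.app i j) v w ↔ v j ∈ w i := Iff.rfl
@[simp] theorem sat_inA (i : ℕ) : SOSat M A (.inA i) v w ↔ v i ∈ A := Iff.rfl
@[simp] theorem sat_not (phi : SOForm) : SOSat M A (.not phi) v w ↔ ¬ SOSat M A phi v w := Iff.rfl
@[simp] theorem sat_and (phi psi : SOForm) :
    SOSat M A (.and phi psi) v w ↔ SOSat M A phi v w ∧ SOSat M A psi v w := Iff.rfl
@[simp] theorem sat_fall (phi : SOForm) :
    SOSat M A (.fall phi) v w ↔ ∀ x ∈ M, SOSat M A phi (consVal x v) w := Iff.rfl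
@[simp] theorem sat_sall (phi : SOForm) :
    SOSat M A (.sall phi) v w ↔ ∀ P ⊆ M, SOSat M A phi v (consVal P w) := Iff.rfl
@[simp] theorem sat_or (phi psi : SOForm) :
    SOSat M A (.or phi psi) v w ↔ SOSat M A phi v w ∨ SOSat M A psi v w := by
  simp [SOForm.or, imp_iff_not_or]
@[simp] theorem sat_imp (phi psi : SOForm) :
    SOSat M A (.imp phi psi) v w ↔ (SOSat M A phi v w → SOSat M A psi v w) := by
  simp [SOForm.imp]
@[simp] theorem sat_iff (phi psi : SOForm) :
    SOSat M A (.iff phi psi) v w ↔ (SOSat M A phi v w ↔ SOSat M A psi v w) := by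
  simp [SOForm.iff, iff_def]
@[simp] theorem sat_fex (phi : SOForm) :
    SOSat M A (.fex phi) v w ↔ ∃ x ∈ M, SOSat M A phi (consVal x v) w := by
  simp [SOForm.fex]

@[simp] theorem consVal_zero {alpha : Type 1} (x : alpha) (v : ℕ → alpha) : consVal x v 0 = x := rfl
@[simp] theorem consVal_succ {alpha : Type 1} (x : alpha) (v : ℕ → alpha) (n : ℕ) :
    consVal x v (n + 1) = v n := rfl
@[simp] theorem consVal_one {alpha : Type 1} (x : alpha) (v : ℕ → alpha) :
    consVal x v 1 = v 0 := rfl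
@[simp] theorem consVal_two {alpha : Type 1} (x : alpha) (v : ℕ → alpha) :
    consVal x v 2 = v 1 := rfl

theorem sat_ren (phi : SOForm) (f : ℕ → ℕ) :
    SOSat M A (phi.ren f) v w ↔ SOSat M A phi v (fun i => w (f i)) := by
  induction phi generalizing f v w with
  | mem | app | inA => exact Iff.rfl
  | not phi ih => exact not_congr (ih v w f)
  | and phi psi ih1 ih2 => exact and_congr (ih1 v w f) (ih2 v w f)
  | fall phi ih => exact forall₂_congr fun x _ => ih (consVal x v) w f
  | sall phi ih =>
    refine forall₂_congr fun P _ => (ih v (consVal P w) _).trans ?_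
    rw [show (fun i => consVal P w (SOForm.liftRen f i)) = consVal P (fun i => w (f i)) from ?_]
    funext i
    cases i <;> rfl

end Sat

section Hierarchy

theorem isPiForm_zero {phi : SOForm} : IsPiForm 0 phi ↔ phi.FO :=
  ⟨fun h => by cases h; assumption, .fo⟩

theorem isSigmaForm_zero {phi : SOForm} : IsSigmaForm 0 phi ↔ phi.FO :=
  ⟨fun h => by cases h; assumption, .fo⟩

@[elab_as_elim]
theorem IsPiForm.succ_induction {n : ℕ} {motive : SOForm → Prop}
    (up : ∀ phi, IsSigmaForm n phi → motive phi)
    (all : ∀ phi, IsPiForm (n + 1) phi → motive phi → motive (.sall phi))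
    {phi : SOForm} (h : IsPiForm (n + 1) phi) : motive phi := by
  refine IsPiForm.rec (motive_1 := fun k phi _ => k = n + 1 → motive phi)
    (motive_2 := fun _ _ _ => True) ?_ ?_ ?_ ?_ ?_ ?_ h rfl
  · rintro phi - ⟨⟩
  · rintro k phi h - ⟨⟩
    exact up phi h
  · rintro k phi h ih ⟨⟩
    exact all phi h (ih rfl)
  · exact fun _ => trivial
  · exact fun _ _ => trivial
  · exact fun _ _ => trivial

@[elab_as_elim]
theorem IsSigmaForm.succ_induction {n : ℕ} {motive : SOForm → Prop}
    (up : ∀ phi, IsPiForm n phi → motive phi)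
    (ex : ∀ phi, IsSigmaForm (n + 1) phi → motive phi → motive (.not (.sall (.not phi))))
    {phi : SOForm} (h : IsSigmaForm (n + 1) phi) : motive phi := by
  refine IsSigmaForm.rec (motive_1 := fun _ _ _ => True)
    (motive_2 := fun k phi _ => k = n + 1 → motive phi) ?_ ?_ ?_ ?_ ?_ ?_ h rfl
  · exact fun _ => trivial
  · exact fun _ _ => trivial
  · exact fun _ _ => trivial
  · rintro phi - ⟨⟩
  · rintro k phi h - ⟨⟩
    exact up phi h
  · rintro k phi h ih ⟨⟩
    exact ex phi h (ih rfl)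

theorem isForm_map (g : ℕ → SOForm → SOForm)
    (hfo : ∀ k phi, phi.FO → (g k phi).FO)
    (hall : ∀ k phi, g k (.sall phi) = .sall (g (k + 1) phi))
    (hnot : ∀ k phi, g k (.not phi) = .not (g k phi)) (n : ℕ) :
    (∀ k phi, IsPiForm n phi → IsPiForm n (g k phi)) ∧
      ∀ k phi, IsSigmaForm n phi → IsSigmaForm n (g k phi) := by
  induction n with
  | zero =>
    simp only [isPiForm_zero, isSigmaForm_zero]
    exact ⟨hfo, hfo⟩
  | succ n ih =>
    constructor
    · intro k phi h
      revert k
      refine IsPiForm.succ_induction (fun phi h k => .up (ih.2 k phi h)) (fun phi _ h k => ?_) h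
      rw [hall]
      exact .all (h _)
    · intro k phi h
      revert k
      refine IsSigmaForm.succ_induction (fun phi h k => .up (ih.1 k phi h)) (fun phi _ h k => ?_) h
      rw [hnot, hall, hnot]
      exact .ex (h _)

theorem isForm_ren (f : ℕ → ℕ) (n : ℕ) (phi : SOForm) :
    (IsPiForm n phi → IsPiForm n (phi.ren f)) ∧
      (IsSigmaForm n phi → IsSigmaForm n (phi.ren f)) := by
  have := isForm_map (fun k phi => phi.ren (SOForm.liftRen^[k] f)) (fun k phi h => h.ren _)
    (fun k phi => by rw [Function.iterate_succ_apply']; rfl) (fun _ _ => rfl) n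
  exact ⟨this.1 0 phi, this.2 0 phi⟩

theorem IsPiForm.ren {n : ℕ} {phi : SOForm} (h : IsPiForm n phi) (f : ℕ → ℕ) :
    IsPiForm n (phi.ren f) := (isForm_ren f n phi).1 h

theorem IsSigmaForm.ren {n : ℕ} {phi : SOForm} (h : IsSigmaForm n phi) (f : ℕ → ℕ) :
    IsSigmaForm n (phi.ren f) := (isForm_ren f n phi).2 h

theorem isForm_succ (n : ℕ) :
    (∀ phi, IsPiForm n phi → IsPiForm (n + 1) phi) ∧
      ∀ phi, IsSigmaForm n phi → IsSigmaForm (n + 1) phi := by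
  induction n with
  | zero =>
    simp only [isPiForm_zero, isSigmaForm_zero]
    exact ⟨fun phi h => .up (.fo h), fun phi h => .up (.fo h)⟩
  | succ n ih =>
    exact ⟨fun phi h => IsPiForm.succ_induction (fun phi h => .up (ih.2 phi h))
      (fun phi _ h => .all h) h, fun phi h => IsSigmaForm.succ_induction
      (fun phi h => .up (ih.1 phi h)) (fun phi _ h => .ex h) h⟩

theorem IsPiForm.of_FO {phi : SOForm} (h : phi.FO) : ∀ n, IsPiForm n phi
  | 0 => .fo h
  | n + 1 => (isForm_succ n).1 phi (IsPiForm.of_FO h n)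

theorem IsSigmaForm.of_FO {phi : SOForm} (h : phi.FO) : ∀ n, IsSigmaForm n phi
  | 0 => .fo h
  | n + 1 => (isForm_succ n).2 phi (IsSigmaForm.of_FO h n)

/-- The relation `R` on structures and valuations is uniformly `Π¹ₙ`-definable. -/
def PiDef (n : ℕ)
    (R : Set ZFSet.{0} → Set ZFSet.{0} → (ℕ → ZFSet.{0}) → (ℕ → Set ZFSet.{0}) → Prop) : Prop :=
  ∃ phi, IsPiForm n phi ∧ ∀ M A v w, SOSat M A phi v w ↔ R M A v w

/-- The relation `R` on structures and valuations is uniformly `Σ¹ₙ`-definable. -/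
def SigmaDef (n : ℕ)
    (R : Set ZFSet.{0} → Set ZFSet.{0} → (ℕ → ZFSet.{0}) → (ℕ → Set ZFSet.{0}) → Prop) : Prop :=
  ∃ phi, IsSigmaForm n phi ∧ ∀ M A v w, SOSat M A phi v w ↔ R M A v w

variable {n : ℕ}
  {R S : Set ZFSet.{0} → Set ZFSet.{0} → (ℕ → ZFSet.{0}) → (ℕ → Set ZFSet.{0}) → Prop}

theorem IsPiForm.def {phi : SOForm} (h : IsPiForm n phi) :
    PiDef n (fun M A v w => SOSat M A phi v w) := ⟨phi, h, fun _ _ _ _ => Iff.rfl⟩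

theorem IsSigmaForm.def {phi : SOForm} (h : IsSigmaForm n phi) :
    SigmaDef n (fun M A v w => SOSat M A phi v w) := ⟨phi, h, fun _ _ _ _ => Iff.rfl⟩

theorem SOForm.FO.piDef {phi : SOForm} (h : phi.FO) :
    PiDef n (fun M A v w => SOSat M A phi v w) := (IsPiForm.of_FO h n).def

theorem SOForm.FO.sigmaDef {phi : SOForm} (h : phi.FO) :
    SigmaDef n (fun M A v w => SOSat M A phi v w) := (IsSigmaForm.of_FO h n).def

theorem PiDef.congr (h : PiDef n R) (hRS : ∀ M A v w, R M A v w ↔ S M A v w) : PiDef n S :=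
  (funext fun M => funext fun A => funext fun v => funext fun w => propext (hRS M A v w) :
    R = S) ▸ h

theorem SigmaDef.congr (h : SigmaDef n R) (hRS : ∀ M A v w, R M A v w ↔ S M A v w) :
    SigmaDef n S :=
  (funext fun M => funext fun A => funext fun v => funext fun w => propext (hRS M A v w) :
    R = S) ▸ h

theorem PiDef.up (h : SigmaDef n R) : PiDef (n + 1) R :=
  let ⟨phi, h1, h2⟩ := h; ⟨phi, .up h1, h2⟩

theorem SigmaDef.up (h : PiDef n R) : SigmaDef (n + 1) R :=
  let ⟨phi, h1, h2⟩ := h; ⟨phi, .up h1, h2⟩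

theorem PiDef.succ (h : PiDef n R) : PiDef (n + 1) R :=
  let ⟨phi, h1, h2⟩ := h; ⟨phi, (isForm_succ n).1 _ h1, h2⟩

theorem PiDef.ren (h : PiDef n R) (f : ℕ → ℕ) :
    PiDef n (fun M A v w => R M A v (fun i => w (f i))) :=
  let ⟨phi, h1, h2⟩ := h
  ⟨phi.ren f, h1.ren f, fun M A v w => (sat_ren M A v w phi f).trans (h2 _ _ _ _)⟩

theorem PiDef.sall (h : PiDef (n + 1) R) :
    PiDef (n + 1) (fun M A v w => ∀ P ⊆ M, R M A v (consVal P w)) :=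
  let ⟨phi, h1, h2⟩ := h
  ⟨.sall phi, .all h1, fun _ _ _ _ => forall₂_congr fun _ _ => h2 _ _ _ _⟩

theorem SigmaDef.sex (h : SigmaDef (n + 1) R) :
    SigmaDef (n + 1) (fun M A v w => ∃ P ⊆ M, R M A v (consVal P w)) :=
  let ⟨phi, h1, h2⟩ := h
  ⟨.not (.sall (.not phi)), .ex h1, fun _ _ _ _ => by simp [h2]⟩

theorem isForm_not (n : ℕ) :
    (∀ phi, IsPiForm n phi → SigmaDef n (fun M A v w => ¬ SOSat M A phi v w)) ∧
      ∀ phi, IsSigmaForm n phi → PiDef n (fun M A v w => ¬ SOSat M A phi v w) := by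
  induction n with
  | zero =>
    simp only [isPiForm_zero, isSigmaForm_zero]
    exact ⟨fun phi h => SOForm.FO.sigmaDef (phi := .not phi) h,
      fun phi h => SOForm.FO.piDef (phi := .not phi) h⟩
  | succ n ih =>
    exact ⟨fun phi h => IsPiForm.succ_induction (fun phi h => .up (ih.2 phi h))
      (fun phi _ h => h.sex.congr (by simp)) h, fun phi h => IsSigmaForm.succ_induction
      (fun phi h => .up (ih.1 phi h)) (fun phi _ h => h.sall.congr (by simp)) h⟩

theorem PiDef.not (h : PiDef n R) : SigmaDef n (fun M A v w => ¬ R M A v w) :=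
  let ⟨phi, h1, h2⟩ := h
  ((isForm_not n).1 phi h1).congr fun _ _ _ _ => not_congr (h2 _ _ _ _)

theorem SigmaDef.not (h : SigmaDef n R) : PiDef n (fun M A v w => ¬ R M A v w) :=
  let ⟨phi, h1, h2⟩ := h
  ((isForm_not n).2 phi h1).congr fun _ _ _ _ => not_congr (h2 _ _ _ _)

theorem IsPiForm.and_or (n : ℕ) : ∀ phi psi, IsPiForm n phi → IsPiForm n psi →
    PiDef n (fun M A v w => SOSat M A phi v w ∧ SOSat M A psi v w) ∧
    PiDef n (fun M A v w => SOSat M A phi v w ∨ SOSat M A psi v w) := by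
  induction n with
  | zero =>
    simp only [isPiForm_zero]
    exact fun phi psi h1 h2 => ⟨SOForm.FO.piDef (phi := .and phi psi) ⟨h1, h2⟩,
      (SOForm.FO.piDef (phi := .or phi psi) ⟨h1, h2⟩).congr (by simp)⟩
  | succ n ih =>
    intro phi psi h1 h2
    revert psi h2
    refine IsPiForm.succ_induction (fun phi h1 psi h2 => ?_) (fun phi hphi ih1 psi h2 => ?_) h1
    · revert phi h1
      refine IsPiForm.succ_induction (fun psi h2 phi h1 => ?_) (fun psi hpsi ih2 phi h1 => ?_) h2
      · obtain ⟨a, ha, ha'⟩ := h1.def.not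
        obtain ⟨b, hb, hb'⟩ := h2.def.not
        refine ⟨.up ((ih a b ha hb).2.not.congr fun _ _ _ _ => ?_),
          .up ((ih a b ha hb).1.not.congr fun _ _ _ _ => ?_)⟩
        · rw [ha', hb']; tauto
        · rw [ha', hb']; tauto
      · obtain ⟨h3, h4⟩ := ih2 _ (h1.ren Nat.succ)
        refine ⟨h3.sall.congr fun M A v w => ?_, h4.sall.congr fun M A v w => ?_⟩
        · simp only [sat_ren, consVal_succ, Nat.succ_eq_add_one, sat_sall]
          exact ⟨fun h => ⟨(h ∅ (by simp)).1, fun P hP => (h P hP).2⟩,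
            fun h P hP => ⟨h.1, h.2 P hP⟩⟩
        · simp only [sat_ren, consVal_succ, Nat.succ_eq_add_one, sat_sall]
          by_cases hc : SOSat M A phi v w <;> simp [hc]
    · obtain ⟨h3, h4⟩ := ih1 _ (h2.ren Nat.succ)
      refine ⟨h3.sall.congr fun M A v w => ?_, h4.sall.congr fun M A v w => ?_⟩
      · simp only [sat_ren, consVal_succ, Nat.succ_eq_add_one, sat_sall]
        exact ⟨fun h => ⟨fun P hP => (h P hP).1, (h ∅ (by simp)).2⟩, fun h P hP => ⟨h.1 P hP, h.2⟩⟩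
      · simp only [sat_ren, consVal_succ, Nat.succ_eq_add_one, sat_sall]
        by_cases hc : SOSat M A psi v w <;> simp [hc]

theorem PiDef.and (h1 : PiDef n R) (h2 : PiDef n S) :
    PiDef n (fun M A v w => R M A v w ∧ S M A v w) :=
  let ⟨phi, h3, h4⟩ := h1
  let ⟨psi, h5, h6⟩ := h2
  (IsPiForm.and_or n phi psi h3 h5).1.congr fun _ _ _ _ => by rw [h4, h6]

/-- A `Π¹ₘ₊₁` formula is a block of universal quantifiers in front of a `Σ¹ₘ` formula. -/
theorem IsPiForm.exists_block {m : ℕ} {phi : SOForm} (h : IsPiForm (m + 1) phi) :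
    ∃ r psi, IsSigmaForm m psi ∧ ∀ M A v w, SOSat M A phi v w ↔
      ∀ w' : ℕ → Set ZFSet.{0}, (∀ i < r, w' i ⊆ M) → (∀ i, w' (i + r) = w i) →
        SOSat M A psi v w' := by
  refine IsPiForm.succ_induction (fun phi h => ⟨0, phi, h, fun M A v w => ?_⟩)
    (fun phi _ ⟨r, psi, h1, h2⟩ => ⟨r + 1, psi, h1, fun M A v w => ?_⟩) h
  · constructor
    · intro h w' _ hw
      rwa [show w' = w from funext hw]
    · exact fun h => h w (by simp) (fun _ => rfl)
  · simp only [sat_sall, h2]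
    constructor
    · intro h w' hw1 hw2
      refine h (w' r) (hw1 r (by omega)) w' (fun i hi => hw1 i (by omega)) fun i => ?_
      cases i with
      | zero => simp
      | succ i => rw [consVal_succ, ← hw2]; congr 1; omega
    · intro h P hP w' hw1 hw2
      refine h w' (fun i hi => ?_) fun i => ?_
      · rcases Nat.lt_succ_iff_lt_or_eq.1 hi with hi | rfl
        · exact hw1 i hi
        · have := hw2 0
          rw [zero_add] at this
          rwa [this]
      · rw [← consVal_succ P w, ← hw2]; congr 1; omega

theorem IsSigmaForm.exists_block {m : ℕ} {phi : SOForm} (h : IsSigmaForm (m + 1) phi) :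
    ∃ r psi, IsPiForm m psi ∧ ∀ M A v w, SOSat M A phi v w ↔
      ∃ w' : ℕ → Set ZFSet.{0}, (∀ i < r, w' i ⊆ M) ∧ (∀ i, w' (i + r) = w i) ∧
        SOSat M A psi v w' := by
  obtain ⟨phi', h1, h2 : ∀ M A v w, _ ↔ ¬ _⟩ := h.def.not
  obtain ⟨r, psi, h3, h4⟩ := h1.exists_block
  obtain ⟨psi', h5, h6⟩ := h3.def.not
  refine ⟨r, psi', h5, fun M A v w => ?_⟩
  rw [← not_iff_not, ← h2, h4]
  simp [h6]

/-- Satisfaction depends on only finitely many first-order variables. -/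
theorem exists_sat_congr (phi : SOForm) : ∃ N : ℕ, ∀ M A v v' w, (∀ i < N, v i = v' i) →
    (SOSat M A phi v w ↔ SOSat M A phi v' w) := by
  induction phi with
  | mem i j =>
    refine ⟨max i j + 1, fun M A v v' w h => ?_⟩
    rw [sat_mem, sat_mem, h i (by omega), h j (by omega)]
  | app i j => exact ⟨j + 1, fun M A v v' w h => by rw [sat_app, sat_app, h j (by omega)]⟩
  | inA j => exact ⟨j + 1, fun M A v v' w h => by rw [sat_inA, sat_inA, h j (by omega)]⟩
  | not phi ih =>
    obtain ⟨N, hN⟩ := ih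
    exact ⟨N, fun M A v v' w h => not_congr (hN M A v v' w h)⟩
  | and phi psi ih1 ih2 =>
    obtain ⟨N, hN⟩ := ih1
    obtain ⟨N', hN'⟩ := ih2
    exact ⟨max N N', fun M A v v' w h => and_congr (hN M A v v' w fun i hi => h i (by omega))
      (hN' M A v v' w fun i hi => h i (by omega))⟩
  | fall phi ih =>
    obtain ⟨N, hN⟩ := ih
    refine ⟨N, fun M A v v' w h => forall₂_congr fun x _ => hN _ _ _ _ _ fun i hi => ?_⟩
    cases i with
    | zero => rfl
    | succ i => exact h i (by omega)
  | sall phi ih =>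
    obtain ⟨N, hN⟩ := ih
    exact ⟨N, fun M A v v' w h => forall₂_congr fun P _ => hN _ _ _ _ _ h⟩

end Hierarchy

/-! ### Reflection with second-order parameters -/

section Vrank

theorem mem_Vrank {x : ZFSet.{0}} {xi : Ordinal.{0}} : x ∈ Vrank xi ↔ x.rank < xi := Iff.rfl

theorem Vrank_mono {xi eta : Ordinal.{0}} (h : xi ≤ eta) : Vrank xi ⊆ Vrank eta :=
  fun _ hx => lt_of_lt_of_le hx h

theorem Vrank_trans {xi : Ordinal.{0}} {x y : ZFSet.{0}} (hx : x ∈ Vrank xi) (hy : y ∈ x) :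
    y ∈ Vrank xi := (ZFSet.rank_lt_of_mem hy).trans hx

theorem Vrank_zero : Vrank 0 = ∅ :=
  Set.eq_empty_of_forall_notMem fun _ hx => absurd (mem_Vrank.1 hx) not_lt_zero

theorem empty_mem_Vrank {xi : Ordinal.{0}} (h : 0 < xi) : ∅ ∈ Vrank xi := by
  rwa [mem_Vrank, ZFSet.rank_empty]

theorem singleton_mem_Vrank {xi : Ordinal.{0}} (h : Order.IsSuccLimit xi) {x : ZFSet.{0}}
    (hx : x ∈ Vrank xi) : {x} ∈ Vrank xi := by
  rw [mem_Vrank, ZFSet.rank_singleton]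
  exact h.succ_lt hx

theorem isSuccLimit_of_singleton_mem_Vrank {xi : Ordinal.{0}} (h0 : xi ≠ 0)
    (h : ∀ x ∈ Vrank xi, {x} ∈ Vrank xi) : Order.IsSuccLimit xi := by
  refine Ordinal.isSuccLimit_iff.2 ⟨h0, Order.isSuccPrelimit_of_succ_lt fun a ha => ?_⟩
  have := h a.toZFSet (by rwa [mem_Vrank, Ordinal.rank_toZFSet])
  rwa [mem_Vrank, ZFSet.rank_singleton, Ordinal.rank_toZFSet] at this

/-- A sequence of injections of the universe with pairwise disjoint ranges. -/
def tag : ℕ → ZFSet.{0} → ZFSet.{0}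
  | 0, x => {x, {x}}
  | c + 1, x => {tag c x}

theorem tag_zero_ne_singleton (x y : ZFSet.{0}) : tag 0 x ≠ {y} := fun h => by
  have h1 : x ∈ tag 0 x := by simp [tag]
  have h2 : {x} ∈ tag 0 x := by simp [tag]
  rw [h, ZFSet.mem_singleton] at h1 h2
  rw [← h1] at h2
  have h3 : x ∈ ({x} : ZFSet.{0}) := ZFSet.mem_singleton.2 rfl
  rw [h2] at h3
  exact ZFSet.mem_irrefl x h3

theorem tag_inj {c d : ℕ} {x y : ZFSet.{0}} : tag c x = tag d y ↔ c = d ∧ x = y := by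
  refine ⟨fun h => ?_, by rintro ⟨rfl, rfl⟩; rfl⟩
  induction c generalizing d with
  | zero =>
    cases d with
    | succ d => exact absurd h (tag_zero_ne_singleton _ _)
    | zero =>
      refine ⟨rfl, ?_⟩
      have h1 : x ∈ tag 0 y := h ▸ (by simp [tag])
      have h2 : y ∈ tag 0 x := h ▸ (by simp [tag])
      simp only [tag, ZFSet.mem_pair] at h1 h2
      rcases h1 with h1 | h1
      · exact h1
      rcases h2 with h2 | h2
      · exact h2.symm
      exact absurd (show x ∈ y by rw [h2]; simp) (ZFSet.mem_asymm (show y ∈ x by rw [h1]; simp))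
  | succ c ih =>
    cases d with
    | zero => exact absurd h.symm (tag_zero_ne_singleton _ _)
    | succ d =>
      obtain ⟨rfl, rfl⟩ := ih (ZFSet.singleton_injective h)
      exact ⟨rfl, rfl⟩

theorem tag_mem_Vrank {xi : Ordinal.{0}} (h : Order.IsSuccLimit xi) {x : ZFSet.{0}}
    (hx : x ∈ Vrank xi) (c : ℕ) : tag c x ∈ Vrank xi := by
  induction c with
  | zero =>
    rw [mem_Vrank, tag, ZFSet.rank_pair, ZFSet.rank_singleton]
    exact max_lt (h.succ_lt hx) (h.succ_lt (h.succ_lt hx))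
  | succ c ih => exact singleton_mem_Vrank h ih

end Vrank

namespace SOForm

/-- Equality of sets. -/
def eqF (i j : ℕ) : SOForm := .fall (.iff (.mem 0 (i + 1)) (.mem 0 (j + 1)))

/-- The `i`-th variable is the singleton of the `j`-th. -/
def singF (i j : ℕ) : SOForm := .fall (.iff (.mem 0 (i + 1)) (eqF 0 (j + 1)))

/-- The `i`-th variable is the image of the `j`-th under `tag c`. -/
def tagF : ℕ → ℕ → ℕ → SOForm
  | 0, i, j => .fall (.iff (.mem 0 (i + 1)) (.or (eqF 0 (j + 1)) (singF 0 (j + 1))))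
  | c + 1, i, j => .fex (.and (tagF c 0 (j + 1)) (singF (i + 1) 0))

/-- The image of the `j`-th variable under `tag c` lies in the unary predicate. -/
def tagInA (c j : ℕ) : SOForm := .fex (.and (tagF c 0 (j + 1)) (.inA 0))

/-- The structure is nonempty and closed under singletons. -/
def limF : SOForm := .and (.fex (eqF 0 0)) (.fall (.fex (singF 0 1)))

/-- Replace the predicate and the second-order variables from `d` on by slices of the predicate. -/
def slice : ℕ → SOForm → SOForm
  | _, .mem i j => .mem i j
  | d, .app i j => if i < d then .app i j else tagInA (i - d + 1) j
  | _, .inA j => tagInA 0 j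
  | d, .not phi => .not (slice d phi)
  | d, .and phi psi => .and (slice d phi) (slice d psi)
  | d, .fall phi => .fall (slice d phi)
  | d, .sall phi => .sall (slice (d + 1) phi)

@[simp] theorem FO_eqF (i j : ℕ) : (eqF i j).FO := by simp [eqF]
@[simp] theorem FO_singF (i j : ℕ) : (singF i j).FO := by simp [singF]
@[simp] theorem FO_tagF (c i j : ℕ) : (tagF c i j).FO := by
  induction c generalizing i j <;> simp_all [tagF]
@[simp] theorem FO_tagInA (c j : ℕ) : (tagInA c j).FO := by simp [tagInA]
@[simp] theorem FO_limF : limF.FO := by simp [limF]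

theorem FO.slice {phi : SOForm} (h : phi.FO) (d : ℕ) : (phi.slice d).FO := by
  induction phi with
  | mem | inA => simp [SOForm.slice]
  | app i j => rw [SOForm.slice]; split_ifs <;> simp
  | not phi ih => exact ih h
  | and phi psi ih1 ih2 => exact ⟨ih1 h.1, ih2 h.2⟩
  | fall phi ih => exact ih h
  | sall phi ih => exact h.elim

end SOForm

theorem IsPiForm.slice {n : ℕ} {phi : SOForm} (h : IsPiForm n phi) (d : ℕ) :
    IsPiForm n (phi.slice d) :=
  (isForm_map SOForm.slice (fun _ _ h => h.slice _) (fun _ _ => rfl) (fun _ _ => rfl) n).1 d phi h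

section

variable {xi : Ordinal.{0}} {A : Set ZFSet.{0}} {v : ℕ → ZFSet.{0}} {w : ℕ → Set ZFSet.{0}}

theorem sat_eqF {i j : ℕ} (hi : v i ∈ Vrank xi) (hj : v j ∈ Vrank xi) :
    SOSat (Vrank xi) A (.eqF i j) v w ↔ v i = v j := by
  simp only [SOForm.eqF, sat_fall, sat_iff, sat_mem, consVal_zero, consVal_succ]
  refine ⟨fun h => ZFSet.ext fun x => ⟨fun hx => ?_, fun hx => ?_⟩, fun h => by simp [h]⟩
  · exact (h x (Vrank_trans hi hx)).1 hx
  · exact (h x (Vrank_trans hj hx)).2 hx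

theorem sat_singF {i j : ℕ} (hi : v i ∈ Vrank xi) (hj : v j ∈ Vrank xi) :
    SOSat (Vrank xi) A (.singF i j) v w ↔ v i = {v j} := by
  simp only [SOForm.singF, sat_fall, sat_iff, sat_mem, consVal_zero, consVal_succ]
  have : ∀ x ∈ Vrank xi, (SOSat (Vrank xi) A (.eqF 0 (j + 1)) (consVal x v) w ↔ x = v j) :=
    fun x hx => sat_eqF (v := consVal x v) hx hj
  constructor
  · refine fun h => ZFSet.ext fun x => ⟨fun hx => ?_, fun hx => ?_⟩
    · have hx' := Vrank_trans hi hx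
      exact ZFSet.mem_singleton.2 ((this x hx').1 ((h x hx').1 hx))
    · rw [ZFSet.mem_singleton] at hx
      rw [hx]
      exact (h _ hj).2 ((this _ hj).2 rfl)
  · intro h x hx
    rw [this x hx, h, ZFSet.mem_singleton]

theorem sat_limF : SOSat (Vrank xi) A .limF v w ↔ Order.IsSuccLimit xi := by
  simp only [SOForm.limF, sat_and, sat_fex, sat_fall]
  constructor
  · rintro ⟨⟨x, hx, -⟩, h⟩
    refine isSuccLimit_of_singleton_mem_Vrank (by rintro rfl; simp [Vrank_zero] at hx)
      fun x hx => ?_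
    obtain ⟨y, hy, h⟩ := h x hx
    rw [sat_singF (by exact hy) (by exact hx)] at h
    simp only [consVal_zero, consVal_one] at h
    rwa [← h]
  · intro h
    refine ⟨⟨∅, empty_mem_Vrank h.bot_lt, ?_⟩, fun x hx => ⟨{x}, singleton_mem_Vrank h hx, ?_⟩⟩
    · simp [SOForm.eqF]
    · exact (sat_singF (by exact singleton_mem_Vrank h hx) (by exact hx)).2 rfl

theorem sat_tagF (h : Order.IsSuccLimit xi) {c i j : ℕ} (hi : v i ∈ Vrank xi)
    (hj : v j ∈ Vrank xi) : SOSat (Vrank xi) A (.tagF c i j) v w ↔ v i = tag c (v j) := by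
  induction c generalizing v i j with
  | zero =>
    simp only [SOForm.tagF, sat_fall, sat_iff, sat_mem, sat_or, consVal_zero, consVal_succ, tag]
    have : ∀ x ∈ Vrank xi, ((SOSat (Vrank xi) A (.eqF 0 (j + 1)) (consVal x v) w ∨
        SOSat (Vrank xi) A (.singF 0 (j + 1)) (consVal x v) w) ↔ x = v j ∨ x = {v j}) :=
      fun x hx => or_congr (sat_eqF (v := consVal x v) hx hj) (sat_singF (v := consVal x v) hx hj)
    constructor
    · refine fun h' => ZFSet.ext fun x => ⟨fun hx => ?_, fun hx => ?_⟩
      · have hx' := Vrank_trans hi hx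
        exact ZFSet.mem_pair.2 ((this x hx').1 ((h' x hx').1 hx))
      · have hx' : x ∈ Vrank xi := Vrank_trans (tag_mem_Vrank h hj 0) hx
        exact (h' x hx').2 ((this x hx').2 (ZFSet.mem_pair.1 hx))
    · intro h' x hx
      rw [this x hx, h', ZFSet.mem_pair]
  | succ c ih =>
    simp only [SOForm.tagF, sat_fex, sat_and, tag]
    constructor
    · rintro ⟨x, hx, h1, h2⟩
      rw [ih (by exact hx) (by exact hj)] at h1
      rw [sat_singF (by exact hi) (by exact hx)] at h2
      simp only [consVal_zero, consVal_succ] at h1 h2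
      rw [h2, h1]
    · intro h1
      have hx := tag_mem_Vrank h hj c
      exact ⟨_, hx, (ih (by exact hx) (by exact hj)).2 rfl,
        (sat_singF (by exact hi) (by exact hx)).2 h1⟩

theorem sat_tagInA (h : Order.IsSuccLimit xi) {c j : ℕ} (hj : v j ∈ Vrank xi) :
    SOSat (Vrank xi) A (.tagInA c j) v w ↔ tag c (v j) ∈ A := by
  simp only [SOForm.tagInA, sat_fex, sat_and, sat_inA, consVal_zero]
  constructor
  · rintro ⟨x, hx, h1, h2⟩
    rw [sat_tagF h (by exact hx) (by exact hj)] at h1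
    simp only [consVal_zero, consVal_succ] at h1
    rwa [← h1]
  · intro h1
    have hx := tag_mem_Vrank h hj c
    exact ⟨_, hx, (sat_tagF h (by exact hx) (by exact hj)).2 rfl, h1⟩

theorem consVal_mem {M : Set ZFSet.{0}} {x : ZFSet.{0}} (hx : x ∈ M) (hv : ∀ i, v i ∈ M) (i : ℕ) :
    consVal x v i ∈ M := by
  cases i with
  | zero => exact hx
  | succ i => exact hv i

theorem sat_slice (h : Order.IsSuccLimit xi) {B : Set ZFSet.{0}} (phi : SOForm) (d : ℕ)
    {w' : ℕ → Set ZFSet.{0}} (hA : ∀ x ∈ Vrank xi, x ∈ A ↔ tag 0 x ∈ B)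
    (hv : ∀ i, v i ∈ Vrank xi) (hlt : ∀ i < d, w' i = w i)
    (hge : ∀ i, ∀ x ∈ Vrank xi, x ∈ w (i + d) ↔ tag (i + 1) x ∈ B) :
    SOSat (Vrank xi) B (phi.slice d) v w' ↔ SOSat (Vrank xi) A phi v w := by
  induction phi generalizing d v w w' with
  | mem i j => exact Iff.rfl
  | app i j =>
    rw [SOForm.slice]
    split_ifs with hi
    · rw [sat_app, sat_app, hlt i hi]
    · rw [sat_tagInA h (hv j), sat_app, ← hge _ _ (hv j), Nat.sub_add_cancel (not_lt.1 hi)]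
  | inA j => rw [SOForm.slice, sat_tagInA h (hv j), sat_inA, hA _ (hv j)]
  | not phi ih => exact not_congr (ih d hv hlt hge)
  | and phi psi ih1 ih2 => exact and_congr (ih1 d hv hlt hge) (ih2 d hv hlt hge)
  | fall phi ih => exact forall₂_congr fun x hx => ih d (consVal_mem hx hv) hlt hge
  | sall phi ih =>
    refine forall₂_congr fun P _ => ih (d + 1) hv (fun i hi => ?_) fun i => hge i
    cases i with
    | zero => rfl
    | succ i => exact hlt i (by omega)

end

/-- Restriction of a second-order valuation to a structure. -/
def restr (w : ℕ → Set ZFSet.{0}) (M : Set ZFSet.{0}) (i : ℕ) : Set ZFSet.{0} := w i ∩ M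

theorem restr_eq_self {w : ℕ → Set ZFSet.{0}} {M : Set ZFSet.{0}} (h : ∀ i, w i ⊆ M) :
    restr w M = w := funext fun i => Set.inter_eq_left.2 (h i)

theorem restr_sub (w : ℕ → Set ZFSet.{0}) (M : Set ZFSet.{0}) (i : ℕ) : restr w M i ⊆ M :=
  Set.inter_subset_right

/-- The valuation of first-order variables by the empty set. -/
def vEmpty : ℕ → ZFSet.{0} := fun _ => ∅

/-- Indescribability reflects relations with arbitrary second-order parameters. -/
theorem PiIndesc.reflect {n : ℕ} {H : Set Ordinal.{0}} {kappa : Ordinal.{0}}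
    (hH : PiIndesc n H kappa) (hk : Order.IsSuccLimit kappa)
    {R : Set ZFSet.{0} → Set ZFSet.{0} → (ℕ → ZFSet.{0}) → (ℕ → Set ZFSet.{0}) → Prop}
    (hR : PiDef n R) (A : Set ZFSet.{0}) (w : ℕ → Set ZFSet.{0})
    (h : R (Vrank kappa) (A ∩ Vrank kappa) vEmpty (restr w (Vrank kappa))) :
    ∃ xi ∈ H, Order.IsSuccLimit xi ∧ R (Vrank xi) (A ∩ Vrank xi) vEmpty (restr w (Vrank xi)) := by
  obtain ⟨phi, hphi, hphi'⟩ := hR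
  obtain ⟨psi, hpsi, hpsi' : ∀ M A v w, _ ↔ _ ∧ _⟩ :=
    (SOForm.FO.piDef (n := n) SOForm.FO_limF).and (hphi.slice 0).def
  let B : Set ZFSet.{0} := {y | y ∈ Vrank kappa ∧ ((∃ x ∈ A, y = tag 0 x) ∨
    ∃ i, ∃ x ∈ w i, y = tag (i + 1) x)}
  have key : ∀ xi ≤ kappa, Order.IsSuccLimit xi →
      (SOSat (Vrank xi) (B ∩ Vrank xi) (phi.slice 0) vEmpty (fun _ => ∅) ↔
        R (Vrank xi) (A ∩ Vrank xi) vEmpty (restr w (Vrank xi))) := by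
    intro xi hxi hlim
    rw [← hphi']
    refine sat_slice hlim phi 0 (fun x hx => ?_) (fun i => empty_mem_Vrank hlim.bot_lt) (by simp)
      fun i x hx => ?_
    · have := tag_mem_Vrank hlim hx 0
      simp [B, tag_inj, hx, this, Vrank_mono hxi this]
    · have := tag_mem_Vrank hlim hx (i + 1)
      simp [B, tag_inj, hx, this, Vrank_mono hxi this, restr]
  obtain ⟨xi, hxi, h'⟩ := hH.2 B (fun x hx => hx.1) psi hpsi ((hpsi' _ _ _ _).2
    ⟨sat_limF.2 hk, by
      have := (key kappa le_rfl hk).2 h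
      rwa [Set.inter_eq_left.2 fun x hx => hx.1] at this⟩)
  have h2 := (hpsi' _ _ _ _).1 h'
  have hlim := sat_limF.1 h2.1
  exact ⟨xi, hxi, hlim, (key xi (hH.1 hxi).le hlim).1 h2.2⟩

/-! ### Positivity and coding -/

namespace SOForm

/-- Turn the unary predicate into the `d`-th second-order variable. -/
def absorb : ℕ → SOForm → SOForm
  | _, .mem i j => .mem i j
  | d, .app i j => if i < d then .app i j else .app (i + 1) j
  | d, .inA j => .app d j
  | d, .not phi => .not (absorb d phi)
  | d, .and phi psi => .and (absorb d phi) (absorb d psi)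
  | d, .fall phi => .fall (absorb d phi)
  | d, .sall phi => .sall (absorb (d + 1) phi)

theorem FO.absorb {phi : SOForm} (h : phi.FO) (d : ℕ) : (phi.absorb d).FO := by
  induction phi with
  | mem | inA => simp [SOForm.absorb]
  | app i j => rw [SOForm.absorb]; split_ifs <;> simp
  | not phi ih => exact ih h
  | and phi psi ih1 ih2 => exact ⟨ih1 h.1, ih2 h.2⟩
  | fall phi ih => exact ih h
  | sall phi ih => exact h.elim

end SOForm

theorem sat_absorb {M A B : Set ZFSet.{0}} (phi : SOForm) (d : ℕ) {v : ℕ → ZFSet.{0}}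
    {w w' : ℕ → Set ZFSet.{0}} (hd : w' d = A) (hlt : ∀ i < d, w' i = w i)
    (hge : ∀ i, d ≤ i → w' (i + 1) = w i) :
    SOSat M B (phi.absorb d) v w' ↔ SOSat M A phi v w := by
  induction phi generalizing d v w w' with
  | mem i j => exact Iff.rfl
  | app i j =>
    rw [SOForm.absorb]
    split_ifs with hi
    · rw [sat_app, sat_app, hlt i hi]
    · rw [sat_app, sat_app, hge i (not_lt.1 hi)]
  | inA j => rw [SOForm.absorb, sat_app, hd, sat_inA]
  | not phi ih => exact not_congr (ih d hd hlt hge)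
  | and phi psi ih1 ih2 => exact and_congr (ih1 d hd hlt hge) (ih2 d hd hlt hge)
  | fall phi ih => exact forall₂_congr fun x _ => ih d hd hlt hge
  | sall phi ih =>
    refine forall₂_congr fun P _ => ih (d + 1) hd (fun i hi => ?_) fun i hi => ?_
    · cases i with
      | zero => rfl
      | succ i => exact hlt i (by omega)
    · cases i with
      | zero => omega
      | succ i => exact hge i (by omega)

theorem PiDef.absorb {n : ℕ}
    {R : Set ZFSet.{0} → Set ZFSet.{0} → (ℕ → ZFSet.{0}) → (ℕ → Set ZFSet.{0}) → Prop}
    (h : PiDef n R) : PiDef n (fun M _ v w => R M (w 0) v (fun i => w (i + 1))) := by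
  obtain ⟨phi, h1, h2⟩ := h
  exact ⟨phi.absorb 0, (isForm_map SOForm.absorb (fun _ _ h => h.absorb _) (fun _ _ => rfl)
    (fun _ _ => rfl) n).1 0 phi h1, fun M A v w =>
    (sat_absorb phi 0 rfl (by simp) (fun _ _ => rfl)).trans (h2 _ _ _ _)⟩

theorem restr_consVal (P M : Set ZFSet.{0}) (w : ℕ → Set ZFSet.{0}) :
    restr (consVal P w) M = consVal (P ∩ M) (restr w M) := by
  funext i
  cases i <;> rfl

/-- A true `Π¹ₙ` statement reflects to a `Π¹ₙ`-indescribable set of ordinals. -/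
theorem PiIndesc.reflect_set {n : ℕ} {H : Set Ordinal.{0}} {kappa : Ordinal.{0}}
    (hH : PiIndesc n H kappa) (hk : Order.IsSuccLimit kappa)
    {R : Set ZFSet.{0} → Set ZFSet.{0} → (ℕ → ZFSet.{0}) → (ℕ → Set ZFSet.{0}) → Prop}
    (hR : PiDef n R) (A : Set ZFSet.{0}) (w : ℕ → Set ZFSet.{0})
    (h : R (Vrank kappa) (A ∩ Vrank kappa) vEmpty (restr w (Vrank kappa))) :
    PiIndesc n {xi | xi ∈ H ∧ Order.IsSuccLimit xi ∧
      R (Vrank xi) (A ∩ Vrank xi) vEmpty (restr w (Vrank xi))} kappa := by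
  refine ⟨fun xi hxi => hH.1 hxi.1, fun B hB phi hphi hsat => ?_⟩
  have hR' := (hR.absorb.ren (fun i => i + 1)).and (hphi.def.ren (fun _ => 0))
  obtain ⟨xi, hxi, hlim, h1, h2⟩ := hH.reflect hk hR' B (consVal ∅ (consVal A w))
    ⟨by simpa only [restr_consVal, consVal_zero, consVal_succ] using h, by
      simp only [restr_consVal, consVal_zero, Set.empty_inter, Set.inter_eq_left.2 hB]
      exact hsat⟩
  simp only [restr_consVal, consVal_zero, consVal_succ, Set.empty_inter] at h1 h2
  exact ⟨xi, ⟨hxi, hlim, h1⟩, h2⟩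

theorem PiIndesc.mono {n : ℕ} {H H' : Set Ordinal.{0}} {kappa : Ordinal.{0}}
    (hH : PiIndesc n H kappa) (h : H ⊆ H') (h' : H' ⊆ Set.Iio kappa) : PiIndesc n H' kappa :=
  ⟨h', fun A hA phi hphi hs => let ⟨xi, hxi, hx⟩ := hH.2 A hA phi hphi hs; ⟨xi, h hxi, hx⟩⟩

theorem PiIndesc.of_succ {n : ℕ} {H : Set Ordinal.{0}} {kappa : Ordinal.{0}}
    (hH : PiIndesc (n + 1) H kappa) : PiIndesc n H kappa :=
  ⟨hH.1, fun A hA phi hphi hs => hH.2 A hA phi ((isForm_succ n).1 _ hphi) hs⟩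

theorem PiIndesc.of_le {m n : ℕ} {H : Set Ordinal.{0}} {kappa : Ordinal.{0}}
    (hH : PiIndesc n H kappa) (h : m ≤ n) : PiIndesc m H kappa := by
  induction h with
  | refl => exact hH
  | step _ ih => exact ih hH.of_succ

/-- Unboundedness for `m = 0` and `Π¹ₘ₋₁`-indescribability for `m > 0`. -/
def PosN : ℕ → Set Ordinal.{0} → Ordinal.{0} → Prop
  | 0, H, kappa => H ⊆ Set.Iio kappa ∧ UnbddIn H kappa
  | m + 1, H, kappa => PiIndesc m H kappa

section PosN

variable {m : ℕ} {H : Set Ordinal.{0}} {kappa : Ordinal.{0}}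

theorem PosN.subset (h : PosN m H kappa) : H ⊆ Set.Iio kappa := by
  cases m <;> exact h.1

theorem PosN.tail (h : PosN m H kappa) (hk : Order.IsSuccLimit kappa) {d : Ordinal.{0}}
    (hd : d < kappa) : PosN m (H ∩ Set.Ioi d) kappa := by
  cases m with
  | zero =>
    refine ⟨fun x hx => h.1 hx.1, fun g hg => ?_⟩
    obtain ⟨e, he, h1, h2⟩ := h.2 _ (max_lt hg hd)
    exact ⟨e, ⟨he, (le_max_right _ _).trans_lt h1⟩, (le_max_left _ _).trans_lt h1, h2⟩
  | succ m =>
    have hR : PiDef m (fun M A v w => SOSat M A (.fex (.app 0 0)) v w) :=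
      SOForm.FO.piDef (by simp)
    refine (PiIndesc.reflect_set h hk hR ∅ (fun _ => {d.toZFSet}) ?_).mono ?_ ?_
    · refine (sat_fex _ _ _ _ _).2 ⟨d.toZFSet, ?_, rfl, ?_⟩
      · rwa [mem_Vrank, Ordinal.rank_toZFSet]
      · rwa [consVal_zero, mem_Vrank, Ordinal.rank_toZFSet]
    · rintro xi ⟨hxi, -, hs⟩
      obtain ⟨x, hx, hx'⟩ := (sat_fex _ _ _ _ _).1 hs
      refine ⟨hxi, ?_⟩
      have : x = d.toZFSet := hx'.1
      rwa [this, mem_Vrank, Ordinal.rank_toZFSet] at hx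
    · exact fun x hx => h.1 hx.1

theorem PosN.nonempty (h : PosN m H kappa) (hk : 0 < kappa) : H.Nonempty := by
  cases m with
  | zero =>
    obtain ⟨d, hd, -⟩ := h.2 0 hk
    exact ⟨d, hd⟩
  | succ m =>
    obtain ⟨xi, hxi, -⟩ := h.2 ∅ (by simp) (.fall (.iff (.mem 0 0) (.mem 0 0)))
      (.of_FO (by simp) m) (by simp [SOSatS])
    exact ⟨xi, hxi⟩

theorem PosN.unbddIn (h : PosN m H kappa) (hk : Order.IsSuccLimit kappa) : UnbddIn H kappa :=
  fun _ hg => let ⟨d, hd⟩ := (h.tail hk hg).nonempty hk.bot_lt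
  ⟨d, hd.1, hd.2, h.subset hd.1⟩

end PosN

/-- An uncountable regular strong limit. -/
def Nice (kappa : Ordinal.{0}) : Prop :=
  RegUncountable kappa ∧ ∀ g < kappa, Cardinal.preBeth g < kappa.card

section Nice

variable {m : ℕ} {S : Set Ordinal.{0}} {kappa : Ordinal.{0}}

theorem RegUncountable.nice_of_two_power (h : RegUncountable kappa)
    (h2 : ∀ g < kappa, 2 ^ g.card < kappa.card) : Nice kappa := by
  refine ⟨h, fun g => ?_⟩
  induction g using Ordinal.limitRecOn with
  | zero =>
    intro _
    rw [Cardinal.preBeth_zero]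
    exact Cardinal.aleph0_pos.trans h.aleph0_lt
  | add_one g ih =>
    intro hg
    have h3 := ih ((Order.lt_succ g).trans hg)
    have h4 : (Cardinal.preBeth g).ord < kappa := by
      rwa [← h.ord_card, Cardinal.ord_lt_ord]
    have := h2 _ h4
    rw [Cardinal.card_ord] at this
    simpa using this
  | limit g hlim ih =>
    intro hg
    obtain ⟨d, hd, hb⟩ := h.exists_bound_Iio hg (fun i => (Cardinal.preBeth i).ord) fun i hi => by
      have := ih i hi (hi.trans hg)
      rwa [← Cardinal.ord_lt_ord, h.ord_card] at this
    rw [Cardinal.preBeth_limit hlim.isSuccPrelimit]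
    refine (ciSup_le' fun i => ?_).trans_lt (h.card_lt hd)
    exact Cardinal.ord_le.1 (hb i.1 i.2).le

theorem nice_of_ineffPos (h : RegUncountable kappa)
    (hS : IneffPos kappa (fun H => PosN m H kappa) S) : Nice kappa := by
  refine h.nice_of_two_power fun g hg => not_le.1 fun hle => ?_
  have hle' : Cardinal.mk (Set.Iio kappa) ≤ Cardinal.mk (Set (Set.Iio g)) := by
    rw [Cardinal.mk_Iio_ordinal, Cardinal.mk_set, Cardinal.mk_Iio_ordinal,
      ← Cardinal.lift_two_power, Cardinal.lift_le]
    exact hle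
  obtain ⟨f⟩ := hle'
  let L : Ordinal.{0} → Set Ordinal.{0} := fun b =>
    {x | x < b ∧ ∃ hb : b < kappa, ∃ hx : x < g, (⟨x, hx⟩ : Set.Iio g) ∈ f ⟨b, hb⟩}
  obtain ⟨H, -, hpos, hhom⟩ := hS.2 L (fun a _ x hx => hx.1)
  have hu := hpos.unbddIn h.isSuccLimit
  obtain ⟨a, ha, hga, hak⟩ := hu g hg
  obtain ⟨b, hb, hab, hbk⟩ := hu a hak
  have heq := hhom a ha b hb hab
  have : f ⟨a, hak⟩ = f ⟨b, hbk⟩ := by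
    ext ⟨x, hx⟩
    have hx' : x < g := hx
    have h1 : x ∈ L a ↔ (⟨x, hx⟩ : Set.Iio g) ∈ f ⟨a, hak⟩ :=
      ⟨fun ⟨_, _, _, h⟩ => h, fun h => ⟨hx'.trans hga, hak, hx, h⟩⟩
    have h2 : x ∈ L b ↔ (⟨x, hx⟩ : Set.Iio g) ∈ f ⟨b, hbk⟩ :=
      ⟨fun ⟨_, _, _, h⟩ => h, fun h => ⟨hx'.trans (hga.trans hab), hbk, hx, h⟩⟩
    rw [← h1, ← h2, heq]
    exact ⟨fun h => h.1, fun h => ⟨h, hx'.trans hga⟩⟩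
  exact hab.ne (congrArg Subtype.val (f.injective this))

/-- Finite tuples of sets of rank below `g`, labelled by natural numbers. -/
def Codes (g : Ordinal.{0}) : Set (ℕ × List ZFSet.{0}) := {p | ∀ x ∈ p.2, x ∈ Vrank g}

theorem Codes_mono {g d : Ordinal.{0}} (h : g ≤ d) : Codes g ⊆ Codes d :=
  fun _ hp x hx => Vrank_mono h (hp x hx)

theorem exists_mem_Codes_succ {xi : Ordinal.{0}} (h0 : 0 < xi) {p : ℕ × List ZFSet.{0}}
    (hp : p ∈ Codes xi) : ∃ r < xi, p ∈ Codes (Order.succ r) := by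
  obtain ⟨i, l⟩ := p
  induction l with
  | nil => exact ⟨0, h0, by simp [Codes]⟩
  | cons x l ih =>
    obtain ⟨r, hr, h1⟩ := ih fun y hy => hp y (List.mem_cons_of_mem _ hy)
    refine ⟨max r x.rank, max_lt hr (hp x List.mem_cons_self), fun y hy => ?_⟩
    rcases List.mem_cons.1 hy with rfl | hy
    · exact Order.lt_succ_of_le (le_max_right r y.rank)
    · exact Vrank_mono (Order.succ_le_succ (le_max_left r x.rank)) (h1 y hy)

theorem mk_Vrank (g : Ordinal.{0}) :
    Cardinal.mk (Vrank g) = Cardinal.lift.{1} (Cardinal.preBeth g) := by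
  have : Vrank g = {x | x ∈ ZFSet.vonNeumann g} := by
    ext x
    rw [mem_Vrank, Set.mem_ofPred_eq, ZFSet.mem_vonNeumann]
  rw [this, ← ZFSet.card_vonNeumann]
  exact ZFSet.cardinalMk_coe_sort

theorem mk_Codes_le (g : Ordinal.{0}) :
    Cardinal.mk (Codes g) ≤ Cardinal.lift.{1} (max Cardinal.aleph0 (Cardinal.preBeth g)) := by
  have hinj : Function.Injective (fun p : Codes g =>
      ((p.1.1, p.1.2.attach.map fun x => (⟨x.1, p.2 x.1 x.2⟩ : Vrank g)) :
        ℕ × List (Vrank g))) := by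
    rintro ⟨⟨i, l⟩, hp⟩ ⟨⟨j, l'⟩, hq⟩ h
    simp only [Prod.mk.injEq] at h
    have := congrArg (List.map Subtype.val) h.2
    simp only [List.map_map] at this
    change List.map Subtype.val l.attach = List.map Subtype.val l'.attach at this
    rw [List.attach_map_subtype_val, List.attach_map_subtype_val] at this
    simp [h.1, this]
  refine (Cardinal.mk_le_of_injective hinj).trans ?_
  rw [Cardinal.mk_prod, Cardinal.mk_nat, Cardinal.lift_aleph0, Cardinal.lift_max,
    Cardinal.lift_aleph0, ← mk_Vrank, Cardinal.lift_id'.{0, 1}]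
  refine (mul_le_mul' le_rfl (Cardinal.mk_list_le_max _)).trans ?_
  exact Cardinal.mul_le_of_le (le_max_left _ _) (le_max_left _ _) le_rfl

theorem Nice.mk_Codes_lt (h : Nice kappa) {g : Ordinal.{0}} (hg : g < kappa) :
    Cardinal.mk (Codes g) < Cardinal.lift.{1} kappa.card :=
  (mk_Codes_le g).trans_lt (Cardinal.lift_lt.2 (max_lt h.1.aleph0_lt (h.2 g hg)))

theorem Nice.exists_coding (h : Nice kappa) :
    ∃ (e : ℕ × List ZFSet.{0} → Ordinal.{0}) (f : Ordinal.{0} → Ordinal.{0}),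
      Set.InjOn e (Codes kappa) ∧ (∀ a < kappa, f a < kappa) ∧
      ∀ xi ∈ closurePts f kappa, ∀ p ∈ Codes xi, e p < xi := by
  have hle : Cardinal.mk (Codes kappa) ≤ Cardinal.mk (Set.Iio kappa) := by
    rw [Cardinal.mk_Iio_ordinal]
    refine (mk_Codes_le kappa).trans (Cardinal.lift_le.2 (max_le h.1.aleph0_lt.le ?_))
    rw [Cardinal.preBeth_limit h.1.isSuccLimit.isSuccPrelimit]
    exact ciSup_le' fun i => (h.2 i.1 i.2).le
  obtain ⟨e'⟩ := hle
  classical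
  let e : ℕ × List ZFSet.{0} → Ordinal.{0} := fun p =>
    if hp : p ∈ Codes kappa then e' ⟨p, hp⟩ else 0
  have he : ∀ p (hp : p ∈ Codes kappa), e p = e' ⟨p, hp⟩ := fun p hp => dif_pos hp
  have hb : ∀ g, ∃ d, g < kappa → d < kappa ∧ ∀ p ∈ Codes (Order.succ g), e p < d := by
    intro g
    by_cases hg : g < kappa
    · obtain ⟨d, hd, hb⟩ := h.1.exists_bound_range (h.mk_Codes_lt (h.1.succ_lt hg))
        (fun p => e p.1) (fun p => by
          rw [he p.1 (Codes_mono (h.1.succ_lt hg).le p.2)]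
          exact (e' _).2)
      exact ⟨d, fun _ => ⟨hd, fun p hp => hb ⟨p, hp⟩⟩⟩
    · exact ⟨0, fun h => absurd h hg⟩
  choose f hf using hb
  refine ⟨e, f, fun p hp q hq hpq => ?_, fun a ha => (hf a ha).1, fun xi hxi p hp => ?_⟩
  · rw [he p hp, he q hq] at hpq
    exact congrArg Subtype.val (e'.injective (Subtype.ext hpq))
  · obtain ⟨r, hr, hpr⟩ := exists_mem_Codes_succ hxi.1 hp
    exact ((hf r (hr.trans hxi.2.1)).2 p hpr).trans (hxi.2.2 r hr)

/-- The coded data at `a` and `b` agree on all tuples of sets of rank below `a`. -/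
def Agree (B : Ordinal.{0} → ℕ → List ZFSet.{0} → Prop) (a b : Ordinal.{0}) : Prop :=
  ∀ i l, (∀ x ∈ l, x ∈ Vrank a) → (B a i l ↔ B b i l)

/-- The list of sets of ordinals coding `B`. -/
def codeList (e : ℕ × List ZFSet.{0} → Ordinal.{0})
    (B : Ordinal.{0} → ℕ → List ZFSet.{0} → Prop) (b : Ordinal.{0}) : Set Ordinal.{0} :=
  {x | x < b ∧ ∃ p ∈ Codes b, B b p.1 p.2 ∧ e p = x}

theorem agree_of_codeList {e : ℕ × List ZFSet.{0} → Ordinal.{0}}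
    {B : Ordinal.{0} → ℕ → List ZFSet.{0} → Prop} {a b : Ordinal.{0}}
    (he : Set.InjOn e (Codes kappa)) (ha : ∀ p ∈ Codes a, e p < a) (hab : a < b) (hb : b < kappa)
    (h : codeList e B a = codeList e B b ∩ Set.Iio a) : Agree B a b := by
  intro i l hl
  have hp : (i, l) ∈ Codes a := hl
  have hea := ha _ hp
  constructor
  · intro h1
    have h2 : e (i, l) ∈ codeList e B a := ⟨hea, _, hp, h1, rfl⟩
    rw [h] at h2
    obtain ⟨⟨-, q, hq, h3, h4⟩, -⟩ := h2
    have := he (Codes_mono hb.le hq) (Codes_mono (hab.trans hb).le hp) h4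
    rwa [this] at h3
  · intro h1
    have h2 : e (i, l) ∈ codeList e B b ∩ Set.Iio a :=
      ⟨⟨hea.trans hab, _, Codes_mono hab.le hp, h1, rfl⟩, hea⟩
    rw [← h] at h2
    obtain ⟨-, q, hq, h3, h4⟩ := h2
    have := he (Codes_mono (hab.trans hb).le hq) (Codes_mono (hab.trans hb).le hp) h4
    rwa [this] at h3

theorem IsSubtleIn.exists_agree (hS : IsSubtleIn S kappa) (h : Nice kappa)
    (B : Ordinal.{0} → ℕ → List ZFSet.{0} → Prop) {C : Set Ordinal.{0}} (hC : IsClubIn C kappa) :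
    ∃ a ∈ S ∩ C, ∃ b ∈ S ∩ C, a < b ∧ Agree B a b := by
  obtain ⟨e, f, he, hf, hef⟩ := h.exists_coding
  obtain ⟨E, hE, hEC⟩ := IsClubIn.exists_inter h.1 hC (isClubIn_closurePts h.1 hf)
  obtain ⟨a, ha, b, hb, hab, heq⟩ := hS.2 (codeList e B) (fun _ _ x hx => hx.1) E hE
  exact ⟨a, ⟨ha.1, (hEC ha.2).1⟩, b, ⟨hb.1, (hEC hb.2).1⟩, hab,
    agree_of_codeList he (hef a (hEC ha.2).2) hab (hS.1 hb.1) heq⟩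

theorem IneffPos.exists_agree (hS : IneffPos kappa (fun H => PosN m H kappa) S) (h : Nice kappa)
    (B : Ordinal.{0} → ℕ → List ZFSet.{0} → Prop) {C : Set Ordinal.{0}} (hC : IsClubIn C kappa) :
    ∃ H ⊆ S ∩ C, PosN m H kappa ∧ ∀ a ∈ H, ∀ b ∈ H, a < b → Agree B a b := by
  obtain ⟨e, f, he, hf, hef⟩ := h.exists_coding
  obtain ⟨g, hg, hgC⟩ := exists_closurePts_subset hC
  let k : Ordinal.{0} → Ordinal.{0} := fun a => max (f a) (g a)
  have hk : ∀ a < kappa, k a < kappa := fun a ha => max_lt (hf a ha) (hg a ha)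
  have hlim := h.1.isSuccLimit
  have hchoice : ∀ b, ∃ x, 0 < b → b < kappa → b ∉ closurePts k kappa → x < b ∧ b ≤ k x := by
    intro b
    by_cases hb : 0 < b ∧ b < kappa ∧ b ∉ closurePts k kappa
    · obtain ⟨h1, h2, h3⟩ := hb
      have : ¬ ∀ x < b, k x < b := fun h4 => h3 ⟨h1, h2, h4⟩
      push Not at this
      obtain ⟨x, hx⟩ := this
      exact ⟨x, fun _ _ _ => hx⟩
    · exact ⟨0, fun h1 h2 h3 => absurd ⟨h1, h2, h3⟩ hb⟩
  choose c hc using hchoice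
  classical
  let L : Ordinal.{0} → Set Ordinal.{0} := fun b =>
    if b ∈ closurePts k kappa then codeList e B b else {c b} ∩ Set.Iio b
  obtain ⟨H, hHS, hpos, hhom⟩ := hS.2 L (fun b _ x hx => by
    simp only [L] at hx
    split_ifs at hx
    · exact hx.1
    · exact hx.2)
  have hbd : ∃ d < kappa, ∀ b ∈ H, d < b → b ∈ closurePts k kappa := by
    by_contra! hcon
    obtain ⟨b, hb, h0, hb'⟩ := hcon 0 h.1.pos
    have hbk := hpos.subset hb
    obtain ⟨h1, h2⟩ := hc b h0 hbk hb'
    obtain ⟨b2, hb2, h3, hb2'⟩ := hcon (max b (k (c b))) (max_lt hbk (hk _ (h1.trans hbk)))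
    have hlt := (le_max_left _ _).trans_lt h3
    have heq := hhom b hb b2 hb2 hlt
    simp only [L, if_neg hb', if_neg hb2'] at heq
    have : c b ∈ ({c b2} ∩ Set.Iio b2) ∩ Set.Iio b := heq ▸ ⟨rfl, h1⟩
    have hcc : c b = c b2 := this.1.1
    have := (hc b2 (h0.trans hlt) (hpos.subset hb2) hb2').2
    rw [← hcc] at this
    exact absurd ((le_max_right _ _).trans_lt h3) (not_lt.2 this)
  obtain ⟨d, hd, hbd⟩ := hbd
  refine ⟨H ∩ Set.Ioi d, fun x hx => ⟨hHS hx.1, hgC (closurePts_anti (fun a => le_max_right _ _)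
    (hbd x hx.1 hx.2))⟩, hpos.tail hlim hd, fun a ha b hb hab => ?_⟩
  have heq := hhom a ha.1 b hb.1 hab
  have ha' := hbd a ha.1 ha.2
  simp only [L, if_pos ha', if_pos (hbd b hb.1 hb.2)] at heq
  exact agree_of_codeList he (hef a (closurePts_anti (fun a => le_max_left _ _) ha')) hab
    (hpos.subset hb.1) heq

end Nice

/-! ### First-order elementarity -/

/-- The first-order valuation given by a tuple. -/
def tupVal (l : List ZFSet.{0}) : ℕ → ZFSet.{0} := fun i => l.getD i ∅

theorem tupVal_map_range {v : ℕ → ZFSet.{0}} {N i : ℕ} (h : i < N) :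
    tupVal ((List.range N).map v) i = v i := by
  simp [tupVal, h]

theorem sat_tupVal {phi : SOForm} {N : ℕ}
    (hN : ∀ M A v v' w, (∀ i < N, v i = v' i) → (SOSat M A phi v w ↔ SOSat M A phi v' w))
    (M A : Set ZFSet.{0}) (v : ℕ → ZFSet.{0}) (w : ℕ → Set ZFSet.{0}) :
    SOSat M A phi (tupVal ((List.range N).map v)) w ↔ SOSat M A phi v w :=
  hN _ _ _ _ _ fun _ hi => tupVal_map_range hi

namespace SOForm

/-- A numbering of formulas. -/
def num : SOForm → ℕ
  | .mem i j => Nat.pair 0 (Nat.pair i j)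
  | .app i j => Nat.pair 1 (Nat.pair i j)
  | .inA i => Nat.pair 2 i
  | .not phi => Nat.pair 3 (num phi)
  | .and phi psi => Nat.pair 4 (Nat.pair (num phi) (num psi))
  | .fall phi => Nat.pair 5 (num phi)
  | .sall phi => Nat.pair 6 (num phi)

theorem num_injective : Function.Injective num := by
  intro phi psi h
  induction phi generalizing psi with
  | mem | app | inA => cases psi <;> simp_all [num, Nat.pair_eq_pair]
  | not _ ih | fall _ ih | sall _ ih =>
    cases psi <;> simp [num, Nat.pair_eq_pair] at h
    rw [ih h]
  | and _ _ ih1 ih2 =>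
    cases psi <;> simp [num, Nat.pair_eq_pair] at h
    rw [ih1 h.1, ih2 h.2]

end SOForm

section Elementary

variable {kappa : Ordinal.{0}}

/-- The first-order truths of `V_κ` are inherited by `V_ξ` for a club of `ξ`. -/
theorem Nice.exists_elementary (h : Nice kappa) {phi : SOForm} (hphi : phi.FO) (A : Set ZFSet.{0})
    (w : ℕ → Set ZFSet.{0}) :
    ∃ f : Ordinal.{0} → Ordinal.{0}, (∀ a < kappa, f a < kappa) ∧
      ∀ xi ∈ closurePts f kappa, ∀ v : ℕ → ZFSet.{0}, (∀ i, v i ∈ Vrank xi) →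
        (SOSat (Vrank xi) (A ∩ Vrank xi) phi v (restr w (Vrank xi)) ↔
          SOSat (Vrank kappa) (A ∩ Vrank kappa) phi v (restr w (Vrank kappa))) := by
  induction phi with
  | mem i j => exact ⟨fun _ => 0, fun _ _ => h.1.pos, fun _ _ _ _ => Iff.rfl⟩
  | app i j =>
    refine ⟨fun _ => 0, fun _ _ => h.1.pos, fun xi hxi v hv => ?_⟩
    simp [restr, hv j, Vrank_mono hxi.2.1.le (hv j)]
  | inA j =>
    refine ⟨fun _ => 0, fun _ _ => h.1.pos, fun xi hxi v hv => ?_⟩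
    simp [hv j, Vrank_mono hxi.2.1.le (hv j)]
  | not phi ih =>
    obtain ⟨f, hf, hf'⟩ := ih hphi
    exact ⟨f, hf, fun xi hxi v hv => not_congr (hf' xi hxi v hv)⟩
  | and phi psi ih1 ih2 =>
    obtain ⟨f, hf, hf'⟩ := ih1 hphi.1
    obtain ⟨g, hg, hg'⟩ := ih2 hphi.2
    exact ⟨fun a => max (f a) (g a), fun a ha => max_lt (hf a ha) (hg a ha), fun xi hxi v hv =>
      and_congr (hf' xi (closurePts_anti (fun a => le_max_left _ _) hxi) v hv)
        (hg' xi (closurePts_anti (fun a => le_max_right _ _) hxi) v hv)⟩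
  | fall phi ih =>
    obtain ⟨f, hf, hf'⟩ := ih hphi
    obtain ⟨N, hN⟩ := exists_sat_congr (.fall phi)
    let Q : List ZFSet.{0} → ZFSet.{0} → Prop := fun l x => x ∈ Vrank kappa ∧
      ¬ SOSat (Vrank kappa) (A ∩ Vrank kappa) phi (consVal x (tupVal l)) (restr w (Vrank kappa))
    have hc : ∀ l : List ZFSet.{0}, ∃ x ∈ Vrank kappa, (∃ y, Q l y) → Q l x := by
      intro l
      by_cases hy : ∃ y, Q l y
      · obtain ⟨y, hy⟩ := hy
        exact ⟨y, hy.1, fun _ => hy⟩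
      · exact ⟨∅, empty_mem_Vrank h.1.pos, fun h => absurd h hy⟩
    choose c hc1 hc2 using hc
    have hb : ∀ g, ∃ d, g < kappa → d < kappa ∧ ∀ p ∈ Codes (Order.succ g), (c p.2).rank < d := by
      intro g
      by_cases hg : g < kappa
      · obtain ⟨d, hd, hb⟩ := h.1.exists_bound_range (h.mk_Codes_lt (h.1.succ_lt hg))
          (fun p => (c p.1.2).rank) (fun p => hc1 _)
        exact ⟨d, fun _ => ⟨hd, fun p hp => hb ⟨p, hp⟩⟩⟩
      · exact ⟨0, fun h => absurd h hg⟩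
    choose g hg using hb
    refine ⟨fun a => max (f a) (g a), fun a ha => max_lt (hf a ha) (hg a ha).1,
      fun xi hxi v hv => ?_⟩
    have hxf := closurePts_anti (fun a => le_max_left (f a) (g a)) hxi
    have hxg := closurePts_anti (fun a => le_max_right (f a) (g a)) hxi
    constructor
    · intro h1
      by_contra h2
      rw [← sat_tupVal hN] at h2
      simp only [sat_fall, not_forall] at h2
      obtain ⟨y, hy, hy'⟩ := h2
      have hl : ∀ x ∈ (List.range N).map v, x ∈ Vrank xi := by simp [hv]
      have hQ := hc2 _ ⟨y, hy, hy'⟩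
      obtain ⟨r, hr, hp⟩ := exists_mem_Codes_succ (p := (0, (List.range N).map v)) hxi.1 hl
      have hx : c ((List.range N).map v) ∈ Vrank xi :=
        ((hg r (hr.trans hxi.2.1)).2 _ hp).trans (hxg.2.2 r hr)
      rw [← sat_tupVal hN] at h1
      refine hQ.2 ((hf' xi hxf _ (consVal_mem hx fun i => ?_)).1 (h1 _ hx))
      rw [tupVal, List.getD_eq_getElem?_getD]
      by_cases hi : i < N
      · simp [hi, hv]
      · simpa [hi] using empty_mem_Vrank hxi.1
    · exact fun h1 x hx => (hf' xi hxf _ (consVal_mem hx hv)).2 (h1 x (Vrank_mono hxi.2.1.le hx))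
  | sall phi => exact hphi.elim

/-- An unbounded chain of elementary substructures consists of elementary substructures of the
union. -/
theorem sat_iff_of_chain {H : Set Ordinal.{0}} (hH : H ⊆ Set.Iio kappa) (hu : UnbddIn H kappa)
    (A : Set ZFSet.{0}) (w : ℕ → Set ZFSet.{0})
    (hchain : ∀ a ∈ H, ∀ b ∈ H, a < b → ∀ phi : SOForm, ∀ l : List ZFSet.{0},
      (∀ x ∈ l, x ∈ Vrank a) →
      (SOSat (Vrank a) (A ∩ Vrank a) phi (tupVal l) (restr w (Vrank a)) ↔
        SOSat (Vrank b) (A ∩ Vrank b) phi (tupVal l) (restr w (Vrank b))))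
    {phi : SOForm} (hphi : phi.FO) {xi : Ordinal.{0}} (hxi : xi ∈ H) {v : ℕ → ZFSet.{0}}
    (hv : ∀ i, v i ∈ Vrank xi) :
    SOSat (Vrank xi) (A ∩ Vrank xi) phi v (restr w (Vrank xi)) ↔
      SOSat (Vrank kappa) (A ∩ Vrank kappa) phi v (restr w (Vrank kappa)) := by
  induction phi generalizing xi v with
  | mem i j => exact Iff.rfl
  | app i j => simp [restr, hv j, Vrank_mono (hH hxi).le (hv j)]
  | inA j => simp [hv j, Vrank_mono (hH hxi).le (hv j)]
  | not phi ih => exact not_congr (ih hphi hxi hv)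
  | and phi psi ih1 ih2 => exact and_congr (ih1 hphi.1 hxi hv) (ih2 hphi.2 hxi hv)
  | fall phi ih =>
    refine ⟨fun h1 x hx => ?_, fun h1 x hx => (ih hphi hxi (consVal_mem hx hv)).2
      (h1 x (Vrank_mono (hH hxi).le hx))⟩
    obtain ⟨b, hb, hlt, -⟩ := hu (max xi x.rank) (max_lt (hH hxi) hx)
    have hxb : xi < b := (le_max_left _ _).trans_lt hlt
    have hx' : x ∈ Vrank b := (le_max_right xi x.rank).trans_lt hlt
    obtain ⟨N, hN⟩ := exists_sat_congr (.fall phi)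
    have h2 := (hchain xi hxi b hb hxb (.fall phi) ((List.range N).map v) (by simp [hv])).1
      ((sat_tupVal hN _ _ _ _).2 h1)
    rw [sat_tupVal hN] at h2
    exact (ih hphi hb (consVal_mem hx' fun i => Vrank_mono hxb.le (hv i))).1 (h2 x hx')
  | sall phi => exact hphi.elim

end Elementary

/-! ### The ideal of non-ineffable sets -/

/-- The code of a set of ordinals as a set of tuples. -/
def ordCode (D : Set Ordinal.{0}) (l : List ZFSet.{0}) : Prop := ∃ g ∈ D, l = [g.toZFSet]

theorem ordCode_singleton {D : Set Ordinal.{0}} {g : Ordinal.{0}} :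
    ordCode D [g.toZFSet] ↔ g ∈ D := by
  simp [ordCode, Ordinal.toZFSet_injective.eq_iff]

theorem Agree.eq_inter {B : Ordinal.{0} → ℕ → List ZFSet.{0} → Prop} {a b : Ordinal.{0}}
    (h : Agree B a b) {i : ℕ} {D E : Set Ordinal.{0}} (hD : B a i = ordCode D)
    (hE : B b i = ordCode E) (hDa : D ⊆ Set.Iio a) : D = E ∩ Set.Iio a := by
  have key : ∀ g < a, (g ∈ D ↔ g ∈ E) := fun g hg => by
    have := h i [g.toZFSet] (by simpa [mem_Vrank] using hg)
    rwa [hD, hE, ordCode_singleton, ordCode_singleton] at this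
  exact Set.ext fun g => ⟨fun hg => ⟨(key g (hDa hg)).1 hg, hDa hg⟩, fun hg => (key g hg.2).2 hg.1⟩

theorem Agree.flag {B : Ordinal.{0} → ℕ → List ZFSet.{0} → Prop} {a b : Ordinal.{0}}
    (h : Agree B a b) (i : ℕ) : B a i [] ↔ B b i [] := h i [] (by simp)

theorem isClubIn_Iio {kappa : Ordinal.{0}} (h : Order.IsSuccLimit kappa) :
    IsClubIn (Set.Iio kappa) kappa :=
  ⟨subset_rfl, fun a ha => ⟨Order.succ a, h.succ_lt ha, Order.lt_succ a⟩, fun _ hb _ _ => hb⟩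

section Ineff

variable {m : ℕ} {S T : Set Ordinal.{0}} {kappa : Ordinal.{0}}

/-- The positive sets with respect to `I(Π¹ₘ₋₁(κ))`. -/
def InPos (m : ℕ) (kappa : Ordinal.{0}) (S : Set Ordinal.{0}) : Prop :=
  IneffPos kappa (fun H => PosN m H kappa) S

theorem InPos.mono (h : InPos m kappa S) (hST : S ⊆ T) (hT : T ⊆ Set.Iio kappa) :
    InPos m kappa T :=
  ⟨hT, fun L hL => let ⟨H, hH, h'⟩ := h.2 L fun a ha => hL a (hST ha); ⟨H, hH.trans hST, h'⟩⟩

theorem InPos.exists_list (h : ¬ InPos m kappa S) (hS : S ⊆ Set.Iio kappa) :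
    ∃ L : Ordinal.{0} → Set Ordinal.{0}, (∀ a ∈ S, L a ⊆ Set.Iio a) ∧
      ∀ H ⊆ S, Homog L H → ¬ PosN m H kappa := by
  have : ¬ ∀ L : Ordinal.{0} → Set Ordinal.{0}, (∀ a ∈ S, L a ⊆ Set.Iio a) →
      ∃ H, H ⊆ S ∧ PosN m H kappa ∧ Homog L H := fun h' => h ⟨hS, h'⟩
  push Not at this
  obtain ⟨L, hL, hbad⟩ := this
  exact ⟨L, hL, fun H h1 h2 h3 => hbad H h1 h3 h2⟩

theorem InPos.nice (h : InPos m kappa S) (hreg : RegUncountable kappa) : Nice kappa :=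
  nice_of_ineffPos hreg h

theorem InPos.exists_agree (h : InPos m kappa S) (hreg : RegUncountable kappa)
    (B : Ordinal.{0} → ℕ → List ZFSet.{0} → Prop) :
    ∃ H ⊆ S, PosN m H kappa ∧ ∀ a ∈ H, ∀ b ∈ H, a < b → Agree B a b := by
  obtain ⟨H, hH, h'⟩ := IneffPos.exists_agree h (h.nice hreg) B (isClubIn_Iio hreg.isSuccLimit)
  exact ⟨H, hH.trans Set.inter_subset_left, h'⟩

theorem InPos.isSubtleIn (h : InPos m kappa S) (hreg : RegUncountable kappa) :
    IsSubtleIn S kappa := by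
  refine ⟨h.1, fun L hL C hC => ?_⟩
  obtain ⟨H, hH, hpos, hag⟩ := IneffPos.exists_agree h (h.nice hreg)
    (fun b _ => ordCode (L b)) hC
  have hu := hpos.unbddIn hreg.isSuccLimit
  obtain ⟨a, ha, -, hak⟩ := hu 0 hreg.pos
  obtain ⟨b, hb, hab, -⟩ := hu a hak
  exact ⟨a, hH ha, b, hH hb, hab, (hag a ha b hb hab).eq_inter (i := 0) rfl rfl (hL a (hH ha).1)⟩

theorem InPos.or_of_union (h : InPos m kappa (S ∪ T)) (hreg : RegUncountable kappa) :
    InPos m kappa S ∨ InPos m kappa T := by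
  by_contra! hcon
  obtain ⟨L, hL, hL'⟩ := InPos.exists_list hcon.1 (Set.subset_union_left.trans h.1)
  obtain ⟨K, hK, hK'⟩ := InPos.exists_list hcon.2 (Set.subset_union_right.trans h.1)
  let B : Ordinal.{0} → ℕ → List ZFSet.{0} → Prop := fun b i => match i with
    | 0 => ordCode (L b)
    | 1 => ordCode (K b)
    | _ => fun _ => b ∈ S
  obtain ⟨H, hH, hpos, hag⟩ := h.exists_agree hreg B
  have hS : ∀ a ∈ H, ∀ b ∈ H, a ∈ S → b ∈ S := by
    intro a ha b hb haS
    rcases lt_trichotomy a b with hab | rfl | hab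
    · exact ((hag a ha b hb hab).flag 2).1 haS
    · exact haS
    · exact ((hag b hb a ha hab).flag 2).2 haS
  by_cases hHS : H ⊆ S
  · exact hL' H hHS (fun a ha b hb hab => (hag a ha b hb hab).eq_inter (i := 0) rfl rfl
      (hL a (hHS ha))) hpos
  · have hHT : H ⊆ T := fun b hb => (hH hb).resolve_left fun hbS =>
      hHS fun a ha => hS b hb a ha hbS
    exact hK' H hHT (fun a ha b hb hab => (hag a ha b hb hab).eq_inter (i := 1) rfl rfl
      (hK a (hHT ha))) hpos

theorem InPos.of_diagUnion {X : Ordinal.{0} → Set Ordinal.{0}}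
    (h : InPos m kappa (diagUnion kappa X)) (hreg : RegUncountable kappa)
    (hX : ∀ a < kappa, X a ⊆ Set.Iio kappa) : ∃ a < kappa, InPos m kappa (X a) := by
  by_contra! hcon
  have hl : ∀ a, ∃ L : Ordinal.{0} → Set Ordinal.{0}, a < kappa →
      (∀ b ∈ X a, L b ⊆ Set.Iio b) ∧ ∀ H ⊆ X a, Homog L H → ¬ PosN m H kappa := by
    intro a
    by_cases ha : a < kappa
    · obtain ⟨L, hL⟩ := InPos.exists_list (hcon a ha) (hX a ha)
      exact ⟨L, fun _ => hL⟩
    · exact ⟨fun _ => ∅, fun h => absurd h ha⟩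
  choose L hL using hl
  have hc : ∀ b, ∃ a, b ∈ diagUnion kappa X → a < b ∧ b ∈ X a := by
    intro b
    by_cases hb : b ∈ diagUnion kappa X
    · obtain ⟨-, a, ha⟩ := hb
      exact ⟨a, fun _ => ha⟩
    · exact ⟨0, fun h => absurd h hb⟩
  choose c hc using hc
  let B : Ordinal.{0} → ℕ → List ZFSet.{0} → Prop := fun b i => match i with
    | 0 => ordCode (L (c b) b)
    | _ => ordCode {c b}
  obtain ⟨H, hH, hpos, hag⟩ := h.exists_agree hreg B
  have hlt : ∀ a ∈ H, ∀ b ∈ H, a < b → c a = c b := fun a ha b hb hab => by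
    have := (hag a ha b hb hab).eq_inter (i := 1) (D := {c a}) (E := {c b}) rfl rfl
      (by simpa using (hc a (hH ha)).1)
    have h1 : c a ∈ ({c b} : Set Ordinal.{0}) ∩ Set.Iio a := this ▸ rfl
    exact h1.1
  obtain ⟨a, ha⟩ := hpos.nonempty hreg.pos
  have hHa : ∀ b ∈ H, c b = c a := by
    intro b hb
    rcases lt_trichotomy a b with hab | rfl | hab
    · exact (hlt a ha b hb hab).symm
    · rfl
    · exact hlt b hb a ha hab
  have hck : c a < kappa := (hc a (hH ha)).1.trans (h.1 (hH ha))
  have hHX : H ⊆ X (c a) := fun b hb => hHa b hb ▸ (hc b (hH hb)).2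
  refine (hL _ hck).2 H hHX (fun x hx y hy hxy => ?_) hpos
  refine (hag x hx y hy hxy).eq_inter (i := 0) ?_ ?_ ((hL _ hck).1 x (hHX hx))
  · rw [← hHa x hx]; rfl
  · rw [← hHa y hy]; rfl

/-- The valuation glued from the valuations indexed by `H`. -/
def glue (w : Ordinal.{0} → ℕ → Set ZFSet.{0}) (H : Set Ordinal.{0}) (i : ℕ) : Set ZFSet.{0} :=
  {x | ∃ xi ∈ H, x ∈ w xi i}

theorem restr_glue {w : Ordinal.{0} → ℕ → Set ZFSet.{0}} {H : Set Ordinal.{0}}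
    (hw : ∀ xi ∈ H, ∀ i, w xi i ⊆ Vrank xi)
    (hag : ∀ a ∈ H, ∀ b ∈ H, a < b → ∀ i, ∀ x ∈ Vrank a, x ∈ w a i ↔ x ∈ w b i)
    {xi : Ordinal.{0}} (hxi : xi ∈ H) : restr (glue w H) (Vrank xi) = w xi := by
  funext i
  refine Set.ext fun x => ⟨fun ⟨⟨eta, heta, hx⟩, hx'⟩ => ?_, fun hx =>
    ⟨⟨xi, hxi, hx⟩, hw xi hxi i hx⟩⟩
  rcases lt_trichotomy xi eta with hlt | rfl | hlt
  · exact (hag xi hxi eta heta hlt i x hx').2 hx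
  · exact hx
  · exact (hag eta heta xi hxi hlt i x (hw eta heta i hx)).1 hx

theorem InPos.piIndesc (h : InPos m kappa S) (hreg : RegUncountable kappa) :
    PiIndesc (m + 1) S kappa := by
  refine ⟨h.1, fun A hA phi hphi hsat => ?_⟩
  by_contra! hcon
  obtain ⟨r, psi, hpsi, hpsi'⟩ := hphi.exists_block
  have hex : ∀ xi, ∃ w : ℕ → Set ZFSet.{0}, xi ∈ S → (∀ i, w i ⊆ Vrank xi) ∧
      (∀ i, w (i + r) = ∅) ∧ ¬ SOSat (Vrank xi) (A ∩ Vrank xi) psi vEmpty w := by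
    intro xi
    by_cases hxi : xi ∈ S
    · have := hcon xi hxi
      rw [SOSatS, hpsi'] at this
      push Not at this
      obtain ⟨w, h1, h2, h3⟩ := this
      refine ⟨w, fun _ => ⟨fun i => ?_, h2, h3⟩⟩
      by_cases hi : i < r
      · exact h1 i hi
      · rw [← Nat.sub_add_cancel (not_lt.1 hi), h2]
        exact Set.empty_subset _
    · exact ⟨fun _ => ∅, fun h => absurd h hxi⟩
  choose w hw using hex
  let B : Ordinal.{0} → ℕ → List ZFSet.{0} → Prop := fun xi i l =>
    (∃ j x, i = Nat.pair 0 j ∧ x ∈ w xi j ∧ l = [x]) ∨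
    ∃ chi : SOForm, i = Nat.pair 1 chi.num ∧ SOSat (Vrank xi) (A ∩ Vrank xi) chi (tupVal l) (w xi)
  obtain ⟨H, hH, hpos, hag⟩ := h.exists_agree hreg B
  have hag1 : ∀ a ∈ H, ∀ b ∈ H, a < b → ∀ i, ∀ x ∈ Vrank a, x ∈ w a i ↔ x ∈ w b i := by
    intro a ha b hb hab i x hx
    have := hag a ha b hb hab (Nat.pair 0 i) [x] (by simpa using hx)
    simpa [B, Nat.pair_eq_pair] using this
  have hwH : ∀ xi ∈ H, restr (glue w H) (Vrank xi) = w xi := fun xi hxi =>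
    restr_glue (fun xi hxi => (hw xi (hH hxi)).1) hag1 hxi
  have hglue : ∀ i, glue w H i ⊆ Vrank kappa := by
    rintro i x ⟨xi, hxi, hx⟩
    exact Vrank_mono (h.1 (hH hxi)).le ((hw xi (hH hxi)).1 i hx)
  have hk : SOSat (Vrank kappa) A psi vEmpty (glue w H) := by
    refine (hpsi' _ _ _ _).1 hsat (glue w H) (fun i _ => hglue i) fun i => ?_
    ext x
    simp only [glue, Set.mem_ofPred_eq, Set.mem_empty_iff_false, iff_false, not_exists, not_and]
    intro xi hxi
    simp [(hw xi (hH hxi)).2.1]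
  have hlim := hreg.isSuccLimit
  cases m with
  | zero =>
    obtain ⟨xi, hxi, h0, hxk⟩ := hpos.2 0 hreg.pos
    refine (hw xi (hH hxi)).2.2 ?_
    rw [← hwH xi hxi, sat_iff_of_chain (v := vEmpty) hpos.1 hpos.2 A (glue w H) ?_
      (isSigmaForm_zero.1 hpsi) hxi (fun i => empty_mem_Vrank h0), Set.inter_eq_left.2 hA,
      restr_eq_self hglue]
    · exact hk
    · intro a ha b hb hab chi l hl
      have := hag a ha b hb hab (Nat.pair 1 chi.num) l hl
      rw [hwH a ha, hwH b hb]
      simpa [B, Nat.pair_eq_pair, SOForm.num_injective.eq_iff] using this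
  | succ m =>
    obtain ⟨s, theta, htheta, htheta'⟩ := hpsi.exists_block
    obtain ⟨w2, h1, h2, h3⟩ := (htheta' _ _ _ _).1 hk
    have hw2 : ∀ i, w2 i ⊆ Vrank kappa := fun i => by
      by_cases hi : i < s
      · exact h1 i hi
      · rw [← Nat.sub_add_cancel (not_lt.1 hi), h2]
        exact hglue _
    obtain ⟨xi, hxi, -, h4⟩ := PiIndesc.reflect hpos hlim htheta.def A w2
      (by rwa [restr_eq_self hw2, Set.inter_eq_left.2 hA])
    refine (hw xi (hH hxi)).2.2
      ((htheta' _ _ _ _).2 ⟨_, fun i _ => restr_sub _ _ i, fun i => ?_, h4⟩)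
    rw [← hwH xi hxi, restr, h2, restr]

theorem IsSubtleIn.mono (h : IsSubtleIn S kappa) (hST : S ⊆ T) (hT : T ⊆ Set.Iio kappa) :
    IsSubtleIn T kappa := by
  refine ⟨hT, fun L hL C hC => ?_⟩
  obtain ⟨a, ha, b, hb, h'⟩ := h.2 L (fun a ha => hL a (hST ha)) C hC
  exact ⟨a, ⟨hST ha.1, ha.2⟩, b, ⟨hST hb.1, hb.2⟩, h'⟩

theorem exists_list_of_not_isSubtleIn (h : ¬ IsSubtleIn S kappa) (hS : S ⊆ Set.Iio kappa) :
    ∃ L : Ordinal.{0} → Set Ordinal.{0}, (∀ a ∈ S, L a ⊆ Set.Iio a) ∧ ∃ C, IsClubIn C kappa ∧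
      ∀ a ∈ S ∩ C, ∀ b ∈ S ∩ C, a < b → L a ≠ L b ∩ Set.Iio a := by
  by_contra! hcon
  exact h ⟨hS, fun L hL C hC => hcon L hL C hC⟩

theorem IsSubtleIn.or_of_union (h : IsSubtleIn (S ∪ T) kappa) (hn : Nice kappa) :
    IsSubtleIn S kappa ∨ IsSubtleIn T kappa := by
  by_contra! hcon
  obtain ⟨L, hL, C, hC, hL'⟩ :=
    exists_list_of_not_isSubtleIn hcon.1 (Set.subset_union_left.trans h.1)
  obtain ⟨K, hK, D, hD, hK'⟩ :=
    exists_list_of_not_isSubtleIn hcon.2 (Set.subset_union_right.trans h.1)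
  obtain ⟨E, hE, hCD⟩ := IsClubIn.exists_inter hn.1 hC hD
  let B : Ordinal.{0} → ℕ → List ZFSet.{0} → Prop := fun b i => match i with
    | 0 => ordCode (L b)
    | 1 => ordCode (K b)
    | _ => fun _ => b ∈ S
  obtain ⟨a, ha, b, hb, hab, hag⟩ := h.exists_agree hn B hE
  have hfl : a ∈ S ↔ b ∈ S := hag.flag 2
  by_cases haS : a ∈ S
  · exact hL' a ⟨haS, (hCD ha.2).1⟩ b ⟨hfl.1 haS, (hCD hb.2).1⟩ hab
      (hag.eq_inter (i := 0) rfl rfl (hL a haS))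
  · have haT := ha.1.resolve_left haS
    have hbT := hb.1.resolve_left fun h => haS (hfl.2 h)
    exact hK' a ⟨haT, (hCD ha.2).2⟩ b ⟨hbT, (hCD hb.2).2⟩ hab
      (hag.eq_inter (i := 1) rfl rfl (hK a haT))

end Ineff

/-! ### Hereditarily indescribable ordinals and Bagaria-style stationarity -/

/-- The ordinals `β` that are inaccessible and `Π¹ᵢ`-indescribable for all `i < m`, as witnessed by
smaller ordinals of the same kind. -/
def Hered : ℕ → Set Ordinal.{0}
  | 0 => {b | Nice b}
  | m + 1 => {b | b ∈ Hered m ∧ PiIndesc m (Hered m ∩ Set.Iio b) b}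

theorem Hered.nice {m : ℕ} {b : Ordinal.{0}} (h : b ∈ Hered m) : Nice b := by
  induction m with
  | zero => exact h
  | succ m ih => exact ih h.1

theorem isSubtleIn_diff_nice {kappa : Ordinal.{0}} (hk : Nice kappa) :
    ¬ IsSubtleIn {b | b < kappa ∧ ¬ Nice b} kappa := by
  intro hS
  let f : Ordinal.{0} → Ordinal.{0} := fun g =>
    max Ordinal.omega0 (Cardinal.preBeth (Order.succ g)).ord
  have hf : ∀ a < kappa, f a < kappa := fun a ha =>
    max_lt hk.1.1 (by rw [← hk.1.ord_card, Cardinal.ord_lt_ord]; exact hk.2 _ (hk.1.succ_lt ha))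
  have hex : ∀ b, ∃ c : Ordinal.{0} → Ordinal.{0}, (∀ i < b.cof.ord, c i < b) ∧
      ∀ a < b, ∃ i < b.cof.ord, a ≤ c i := by
    intro b
    obtain ⟨c, hc⟩ := Ordinal.exists_isFundamentalSeq (o := b) rfl
    refine ⟨fun i => if h : i < b.cof.ord then c ⟨i, h⟩ else 0, fun i hi => ?_, fun a ha => ?_⟩
    · simp only [hi, dif_pos]
      exact (c ⟨i, hi⟩).2
    · obtain ⟨_, ⟨i, rfl⟩, hi⟩ := hc.isCofinal_range ⟨a, ha⟩
      have hi2 : i.1 < b.cof.ord := i.2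
      exact ⟨i, i.2, by simp only [hi2, dif_pos]; exact hi⟩
  choose c hc1 hc2 using hex
  let B : Ordinal.{0} → ℕ → List ZFSet.{0} → Prop := fun b i => match i with
    | 0 => ordCode {b.cof.ord}
    | _ => fun l => ∃ i < b.cof.ord, l = [i.toZFSet, (c b i).toZFSet]
  obtain ⟨a, ⟨ha, haC⟩, b, ⟨hb, hbC⟩, hab, hag⟩ :=
    hS.exists_agree hk B (isClubIn_closurePts hk.1 hf)
  have hsing : ∀ x ∈ closurePts f kappa, ¬ Nice x → x.cof.ord < x := by
    intro x hx hn
    refine lt_of_le_of_ne (Ordinal.ord_cof_le x) fun heq => hn ⟨⟨?_, heq⟩, fun g hg => ?_⟩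
    · exact (le_max_left _ _).trans_lt (hx.2.2 0 hx.1)
    · refine (Cardinal.preBeth_strictMono (Order.lt_succ g)).trans_le ?_
      rw [← Cardinal.ord_le]
      exact ((le_max_right _ _).trans_lt (hx.2.2 g hg)).le
  have hmu := hsing a haC ha.2
  have heq : a.cof.ord ∈ ({b.cof.ord} : Set Ordinal.{0}) ∩ Set.Iio a :=
    hag.eq_inter (i := 0) (D := {a.cof.ord}) rfl rfl (by simpa using hmu) ▸ rfl
  obtain ⟨i, hi, hai⟩ := hc2 b a hab
  rw [← (heq.1 : a.cof.ord = b.cof.ord)] at hi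
  have h1 : B a 1 [i.toZFSet, (c a i).toZFSet] := ⟨i, hi, rfl⟩
  rw [hag 1 _ (by simp [mem_Vrank, hi.trans hmu, hc1 a i hi])] at h1
  obtain ⟨j, -, hj⟩ := h1
  simp only [List.cons.injEq, Ordinal.toZFSet_injective.eq_iff, and_true] at hj
  rw [← hj.1] at hj
  exact (hj.2 ▸ hc1 a i hi).not_ge hai

theorem isSubtleIn_diff_hered {kappa : Ordinal.{0}} (hk : Nice kappa) (m : ℕ) :
    ¬ IsSubtleIn {b | b < kappa ∧ b ∉ Hered m} kappa := by
  induction m with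
  | zero => exact isSubtleIn_diff_nice hk
  | succ m ih =>
    intro hS
    have hsub : {b | b < kappa ∧ b ∉ Hered (m + 1)} ⊆ {b | b < kappa ∧ b ∉ Hered m} ∪
        {b | b < kappa ∧ b ∈ Hered m ∧ ¬ PiIndesc m (Hered m ∩ Set.Iio b) b} := fun b hb => by
      by_cases h : b ∈ Hered m
      · exact Or.inr ⟨hb.1, h, fun h' => hb.2 ⟨h, h'⟩⟩
      · exact Or.inl ⟨hb.1, h⟩
    have hS' :=
      ((hS.mono hsub (by rintro b (hb | hb) <;> exact hb.1)).or_of_union hk).resolve_left ih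
    have hex : ∀ b, ∃ A phi, ¬ PiIndesc m (Hered m ∩ Set.Iio b) b →
        A ⊆ Vrank b ∧ SOSatS (Vrank b) A phi ∧
          ∀ xi ∈ Hered m ∩ Set.Iio b, ¬ SOSatS (Vrank xi) (A ∩ Vrank xi) phi := by
      intro b
      by_contra! hcon
      refine (hcon ∅ (.mem 0 0)).1 ⟨Set.inter_subset_right, fun A hA phi _ hsat => ?_⟩
      exact (hcon A phi).2 hA hsat
    choose A phi hA using hex
    let B : Ordinal.{0} → ℕ → List ZFSet.{0} → Prop := fun b i => match i with
      | 0 => fun l => ∃ x ∈ A b, l = [x]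
      | i + 1 => fun _ => (phi b).num = i
    obtain ⟨a, ⟨ha, -⟩, b, ⟨hb, -⟩, hab, hag⟩ :=
      hS'.exists_agree hk B (isClubIn_Iio hk.1.isSuccLimit)
    have hphi : phi b = phi a := SOForm.num_injective ((hag.flag ((phi a).num + 1)).1 rfl)
    have hAab : A b ∩ Vrank a = A a := by
      ext x
      have key : ∀ hx : x ∈ Vrank a, x ∈ A a ↔ x ∈ A b := fun hx => by
        simpa [B] using hag 0 [x] (by simpa using hx)
      exact ⟨fun hx => (key hx.2).2 hx.1, fun hx =>
        have hx' := (hA a ha.2.2).1 hx; ⟨(key hx').1 hx, hx'⟩⟩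
    refine (hA b hb.2.2).2.2 a ⟨ha.2.1, hab⟩ ?_
    rw [hphi, hAab]
    exact (hA a ha.2.2).2.1

/-- `C` is closed under reflecting a notion of stationarity at the ordinals of `G`. -/
def ReflClosed (G : Set Ordinal.{0}) (St : Set Ordinal.{0} → Ordinal.{0} → Prop)
    (D : Set Ordinal.{0}) (b : Ordinal.{0}) : Prop :=
  ∀ a ∈ G, a < b → St (D ∩ Set.Iio a) a → a ∈ D

/-- Iterated stationarity. -/
def Stat : ℕ → Set Ordinal.{0} → Ordinal.{0} → Prop
  | 0, C, b => UnbddIn C b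
  | m + 1, C, b => ∀ D ⊆ Set.Iio b, Stat m D b → ReflClosed (Hered m) (Stat m) D b →
      (C ∩ D).Nonempty

/-! ### Definability of iterated stationarity -/

/-- The ordinals coded in a class. -/
def pre (P : Set ZFSet.{0}) : Set Ordinal.{0} := {a | a.toZFSet ∈ P}

theorem mem_pre {P : Set ZFSet.{0}} {a : Ordinal.{0}} : a ∈ pre P ↔ a.toZFSet ∈ P := Iff.rfl

theorem pre_image (D : Set Ordinal.{0}) : pre (Ordinal.toZFSet '' D) = D :=
  Set.ext fun _ => Ordinal.toZFSet_injective.mem_set_image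

theorem toZFSet_mem_Vrank {a b : Ordinal.{0}} : a.toZFSet ∈ Vrank b ↔ a < b := by
  rw [mem_Vrank, Ordinal.rank_toZFSet]

theorem image_subset_Vrank {D : Set Ordinal.{0}} {b : Ordinal.{0}} (h : D ⊆ Set.Iio b) :
    Ordinal.toZFSet '' D ⊆ Vrank b := by
  rintro _ ⟨a, ha, rfl⟩
  exact toZFSet_mem_Vrank.2 (h ha)

theorem pre_subset {P : Set ZFSet.{0}} {b : Ordinal.{0}} (h : P ⊆ Vrank b) : pre P ⊆ Set.Iio b :=
  fun _ ha => toZFSet_mem_Vrank.1 (h ha)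

theorem pre_inter_Vrank (P : Set ZFSet.{0}) (b : Ordinal.{0}) :
    pre (P ∩ Vrank b) = pre P ∩ Set.Iio b :=
  Set.ext fun _ => and_congr Iff.rfl toZFSet_mem_Vrank

/-- The set coding the pair of an ordinal `a` and a set `D ⊆ a`. -/
noncomputable def enc (a : Ordinal.{0}) (D : Set Ordinal.{0}) : ZFSet.{0} :=
  ZFSet.sep (fun x => x = a.toZFSet ∨ ∃ d ∈ D, x = d.toZFSet) (Order.succ a).toZFSet

theorem mem_enc {a : Ordinal.{0}} {D : Set Ordinal.{0}} (hD : D ⊆ Set.Iio a) {x : ZFSet.{0}} :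
    x ∈ enc a D ↔ x = a.toZFSet ∨ ∃ d ∈ D, x = d.toZFSet := by
  rw [enc, ZFSet.mem_sep, and_iff_right_iff_imp]
  rintro (rfl | ⟨d, hd, rfl⟩)
  · exact Ordinal.toZFSet_mem_toZFSet_iff.2 (Order.lt_succ a)
  · exact Ordinal.toZFSet_mem_toZFSet_iff.2 ((hD hd).trans (Order.lt_succ a))

theorem enc_mem_Vrank {a b : Ordinal.{0}} (hb : Order.IsSuccLimit b) (hab : a < b)
    (D : Set Ordinal.{0}) : enc a D ∈ Vrank b := by
  refine (ZFSet.rank_mono (y := (Order.succ a).toZFSet) fun x hx => ?_).trans_lt ?_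
  · exact (ZFSet.mem_sep.1 hx).1
  · rw [Ordinal.rank_toZFSet]
    exact hb.succ_lt hab

/-- The class coding a relation between ordinals and their subsets. -/
def encClass (Lam : Ordinal.{0} → Set Ordinal.{0} → Prop) : Set ZFSet.{0} :=
  {z | ∃ a D, D ⊆ Set.Iio a ∧ Lam a D ∧ z = enc a D}

/-- The variable `j` is an ordinal whose intersection with the class `p` is related to it by the
relation coded by the class `t`. -/
def lookF (t p j : ℕ) : SOForm :=
  .fex (.and (.app t 0) (.and (.mem (j + 1) 0)
    (.and (.fall (.imp (.mem 0 1) (.not (.mem (j + 2) 0))))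
      (.fall (.imp (.mem 0 (j + 2)) (.iff (.mem 0 1) (.app p 0)))))))

theorem FO_lookF (t p j : ℕ) : (lookF t p j).FO := by simp [lookF]

theorem sat_lookF {Lam : Ordinal.{0} → Set Ordinal.{0} → Prop} {b : Ordinal.{0}}
    (hb : Order.IsSuccLimit b) {A : Set ZFSet.{0}} {v : ℕ → ZFSet.{0}} {w : ℕ → Set ZFSet.{0}}
    {t p j : ℕ} (ht : w t = encClass Lam ∩ Vrank b) :
    SOSat (Vrank b) A (lookF t p j) v w ↔
      ∃ a < b, v j = a.toZFSet ∧ Lam a (pre (w p) ∩ Set.Iio a) := by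
  simp only [lookF, sat_fex, sat_and, sat_app, sat_mem, sat_fall, sat_imp, sat_not, sat_iff,
    consVal_zero, consVal_succ, ht]
  constructor
  · rintro ⟨z, hz, ⟨⟨a, D, hD, hL, rfl⟩, -⟩, h1, h2, h3⟩
    have hab : a < b := by
      have : a.toZFSet ∈ enc a D := (mem_enc hD).2 (Or.inl rfl)
      exact toZFSet_mem_Vrank.1 (Vrank_trans hz this)
    have hja : v j = a.toZFSet := by
      rcases (mem_enc hD).1 h1 with h | ⟨d, hd, h⟩
      · exact h
      · refine absurd ?_ (h2 a.toZFSet (toZFSet_mem_Vrank.2 hab) ((mem_enc hD).2 (Or.inl rfl)))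
        rw [h]
        exact Ordinal.toZFSet_mem_toZFSet_iff.2 (hD hd)
    refine ⟨a, hab, hja, ?_⟩
    have hDp : D = pre (w p) ∩ Set.Iio a := by
      ext g
      have key : g < a → (g ∈ D ↔ g ∈ pre (w p)) := fun hg => by
        have := h3 g.toZFSet (toZFSet_mem_Vrank.2 (hg.trans hab))
          (hja ▸ Ordinal.toZFSet_mem_toZFSet_iff.2 hg)
        rw [mem_enc hD, Ordinal.toZFSet_injective.eq_iff, or_iff_right hg.ne] at this
        simpa [Ordinal.toZFSet_injective.eq_iff, mem_pre] using this
      exact ⟨fun hg => ⟨(key (hD hg)).1 hg, hD hg⟩, fun hg => (key hg.2).2 hg.1⟩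
    rwa [← hDp]
  · rintro ⟨a, hab, hja, hL⟩
    have hD : pre (w p) ∩ Set.Iio a ⊆ Set.Iio a := Set.inter_subset_right
    refine ⟨_, enc_mem_Vrank hb hab _, ⟨⟨a, _, hD, hL, rfl⟩, enc_mem_Vrank hb hab _⟩, ?_, ?_, ?_⟩
    · exact (mem_enc hD).2 (Or.inl hja)
    · intro x _ hx
      rw [hja]
      rcases (mem_enc hD).1 hx with rfl | ⟨d, hd, rfl⟩
      · exact ZFSet.mem_irrefl _
      · rw [Ordinal.toZFSet_mem_toZFSet_iff]
        exact hd.2.le.not_gt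
    · intro x _ hx
      rw [hja, Ordinal.mem_toZFSet_iff] at hx
      obtain ⟨g, hg, rfl⟩ := hx
      rw [mem_enc hD]
      simp [Ordinal.toZFSet_injective.eq_iff, hg.ne, hg, mem_pre]

/-- The parameters used to define iterated stationarity. -/
def IsStatParam (b : Ordinal.{0}) (w : ℕ → Set ZFSet.{0}) : Prop :=
  w 0 = Set.range Ordinal.toZFSet ∩ Vrank b ∧
    ∀ i, w (i + 1) = encClass (fun a D => a ∈ Hered i ∧ Stat i D a) ∩ Vrank b

/-- A valuation containing the parameters. -/
def statParam : ℕ → Set ZFSet.{0}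
  | 0 => Set.range Ordinal.toZFSet
  | i + 1 => encClass fun a D => a ∈ Hered i ∧ Stat i D a

theorem isStatParam_restr (b : Ordinal.{0}) : IsStatParam b (restr statParam (Vrank b)) :=
  ⟨rfl, fun _ => rfl⟩

theorem exists_piDef_stat (m : ℕ) : ∃ R : Set ZFSet.{0} → Set ZFSet.{0} → (ℕ → ZFSet.{0}) →
    (ℕ → Set ZFSet.{0}) → Prop, PiDef m R ∧ ∀ b, Order.IsSuccLimit b → ∀ A v w,
      IsStatParam b (fun i => w (i + 1)) → (R (Vrank b) A v w ↔ Stat m (pre (w 0)) b) := by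
  induction m with
  | zero =>
    let phi : SOForm :=
      .fall (.imp (.app 1 0) (.fex (.and (.app 1 0) (.and (.app 0 0) (.mem 1 0)))))
    have hphi : phi.FO := by simp [phi]
    refine ⟨_, hphi.piDef, fun b hb A v w hw => ?_⟩
    simp only [phi, sat_fex, sat_and, sat_app, sat_mem, sat_fall, sat_imp, consVal_zero,
      consVal_one, hw.1]
    constructor
    · intro h g hg
      obtain ⟨y, hy, ⟨⟨d, rfl⟩, -⟩, h1, h2⟩ :=
        h g.toZFSet (toZFSet_mem_Vrank.2 hg) ⟨⟨g, rfl⟩, toZFSet_mem_Vrank.2 hg⟩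
      exact ⟨d, h1, Ordinal.toZFSet_mem_toZFSet_iff.1 h2, toZFSet_mem_Vrank.1 hy⟩
    · rintro h _ - ⟨⟨g, rfl⟩, hg⟩
      obtain ⟨d, hd, hgd, hdb⟩ := h g (toZFSet_mem_Vrank.1 hg)
      have hdb' := toZFSet_mem_Vrank.2 hdb
      exact ⟨_, hdb', ⟨⟨d, rfl⟩, hdb'⟩, hd, Ordinal.toZFSet_mem_toZFSet_iff.2 hgd⟩
  | succ m ih =>
    obtain ⟨R, hR, hR'⟩ := ih
    let clo : SOForm := .fall (.imp (lookF (m + 3) 0 0) (.app 0 0))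
    let meet : SOForm := .fex (.and (.app 2 0) (.and (.app 1 0) (.app 0 0)))
    have hclo : clo.FO := by simp [clo, FO_lookF]
    have hmeet : (SOForm.not meet).FO := by simp [meet]
    have hdef := (PiDef.up ((hR.ren (fun i => if i = 0 then 0 else i + 1)).and
      (hclo.piDef.and hmeet.piDef)).not).sall
    refine ⟨_, hdef, fun b hb A v w hw => ?_⟩
    have key : ∀ P ⊆ Vrank b,
        (¬ (R (Vrank b) A v (fun i => consVal P w (if i = 0 then 0 else i + 1)) ∧
          SOSat (Vrank b) A clo v (consVal P w) ∧
          SOSat (Vrank b) A (.not meet) v (consVal P w)) ↔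
        (Stat m (pre P) b → ReflClosed (Hered m) (Stat m) (pre P) b →
          (pre (w 0) ∩ pre P).Nonempty)) := by
      intro P hP
      have h0 : R (Vrank b) A v (fun i => consVal P w (if i = 0 then 0 else i + 1)) ↔
          Stat m (pre P) b := hR' b hb A v _ hw
      have h1 : SOSat (Vrank b) A clo v (consVal P w) ↔
          ReflClosed (Hered m) (Stat m) (pre P) b := by
        have ht : consVal P w (m + 3) = encClass (fun a D => a ∈ Hered m ∧ Stat m D a) ∩ Vrank b :=
          hw.2 m
        simp only [clo, sat_fall, sat_imp, sat_app]
        constructor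
        · intro h a ha hab hs
          have hab' := toZFSet_mem_Vrank.2 hab
          exact h a.toZFSet hab' ((sat_lookF hb ht).2 ⟨a, hab, rfl, ha, hs⟩)
        · intro h x hx hl
          obtain ⟨a, hab, hxa, ha, hs⟩ := (sat_lookF hb ht).1 hl
          rw [hxa]
          exact h a ha hab hs
      have h2 : SOSat (Vrank b) A (.not meet) v (consVal P w) ↔ ¬ (pre (w 0) ∩ pre P).Nonempty := by
        have hw1 : w 1 = _ := hw.1
        simp only [meet, sat_not, sat_fex, sat_and, sat_app, consVal_zero, consVal_one, consVal_two,
          hw1]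
        refine not_congr ⟨?_, ?_⟩
        · rintro ⟨_, -, ⟨⟨a, rfl⟩, -⟩, h1, h2⟩
          exact ⟨a, h1, h2⟩
        · rintro ⟨a, h1, h2⟩
          exact ⟨a.toZFSet, hP h2, ⟨⟨a, rfl⟩, hP h2⟩, h1, h2⟩
      rw [h0, h1, h2]
      tauto
    constructor
    · intro h D hD
      have := (key _ (image_subset_Vrank hD)).1 (h _ (image_subset_Vrank hD))
      rwa [pre_image] at this
    · exact fun h P hP => (key P hP).2 (h _ (pre_subset hP))

/-! ### Stationary sets and indescribability -/

theorem UnbddIn.closurePts_mem {C : Set Ordinal.{0}} {f : Ordinal.{0} → Ordinal.{0}}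
    {kappa a : Ordinal.{0}} (h : UnbddIn (closurePts f kappa ∩ C) a) (ha0 : 0 < a)
    (hak : a < kappa) : a ∈ closurePts f kappa := by
  refine ⟨ha0, hak, fun g hg => ?_⟩
  obtain ⟨d, hd, hgd, hda⟩ := h g hg
  exact (hd.1.2.2 g hgd).trans hda

/-- At hereditarily indescribable ordinals, iterated stationarity implies indescribability. -/
theorem Stat.posN {m : ℕ} {b : Ordinal.{0}} {H : Set Ordinal.{0}} (h : Stat m H b)
    (hb : b ∈ Hered m) : PosN m (H ∩ Set.Iio b) b := by
  induction m using Nat.strong_induction_on generalizing b H with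
  | _ m ih =>
  have hlim := (Hered.nice hb).1.isSuccLimit
  rcases m with _ | _ | m
  · refine ⟨Set.inter_subset_right, fun g hg => ?_⟩
    obtain ⟨d, hd, hgd, hdb⟩ := h g hg
    exact ⟨d, ⟨hd, hdb⟩, hgd, hdb⟩
  · refine ⟨Set.inter_subset_right, fun A hA phi hphi hsat => ?_⟩
    obtain ⟨f, hf, hf'⟩ :=
      (Hered.nice hb).exists_elementary (isPiForm_zero.1 hphi) A (fun _ => ∅)
    have hclub := isClubIn_closurePts (Hered.nice hb).1 hf
    obtain ⟨xi, hxi, hxi'⟩ := h (closurePts f b) hclub.1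
      (fun g hg => let ⟨d, hd, hgd⟩ := hclub.2.1 g hg; ⟨d, hd, hgd, hclub.1 hd⟩)
      (fun a ha hab hu => UnbddIn.closurePts_mem hu (Hered.nice ha).1.pos hab)
    refine ⟨xi, ⟨hxi, hxi'.2.1⟩, ?_⟩
    have hr : ∀ M : Set ZFSet.{0}, restr (fun _ => ∅) M = fun _ => ∅ :=
      fun M => funext fun _ => Set.empty_inter M
    have := hf' xi hxi' vEmpty fun _ => empty_mem_Vrank hxi'.1
    rw [hr, hr, Set.inter_eq_left.2 hA] at this
    exact this.2 hsat
  · refine ⟨Set.inter_subset_right, fun A hA phi hphi hsat => ?_⟩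
    let D : Set Ordinal.{0} :=
      {xi | xi ∈ Hered (m + 1) ∧ xi < b ∧ SOSatS (Vrank xi) (A ∩ Vrank xi) phi}
    have hind : PiIndesc (m + 1) (Hered (m + 1) ∩ Set.Iio b) b := hb.2
    have hD : Stat (m + 1) D b := by
      intro E hE hst hclo
      obtain ⟨R, hR, hR'⟩ := exists_piDef_stat m
      have hs := hind.reflect_set hlim hR.succ ∅
        (consVal (Ordinal.toZFSet '' E) statParam) (by
          rw [restr_consVal, hR' b hlim _ _ _ (isStatParam_restr b), consVal_zero,
            pre_inter_Vrank, pre_image, Set.inter_eq_left.2 hE]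
          exact hst)
      obtain ⟨xi, ⟨⟨hxi, hxb⟩, hxl, hx⟩, hxs⟩ := hs.2 A hA phi hphi hsat
      rw [restr_consVal, hR' xi hxl _ _ _ (isStatParam_restr xi), consVal_zero, pre_inter_Vrank,
        pre_image] at hx
      exact ⟨xi, ⟨hxi, hxb, hxs⟩, hclo xi hxi.1 hxb hx⟩
    have hclo : ReflClosed (Hered (m + 1)) (Stat (m + 1)) D b := by
      intro a ha hab hst
      refine ⟨ha, hab, by_contra fun hns => ?_⟩
      have hp : PiIndesc m (D ∩ Set.Iio a ∩ Set.Iio a) a := ih (m + 1) (by omega) hst ha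
      obtain ⟨r, psi, hpsi, hpsi'⟩ := hphi.exists_block
      rw [SOSatS, hpsi'] at hns
      push Not at hns
      obtain ⟨w, hw1, hw2, hw3⟩ := hns
      have hw : ∀ i, w i ⊆ Vrank a := fun i => by
        by_cases hi : i < r
        · exact hw1 i hi
        · rw [← Nat.sub_add_cancel (not_lt.1 hi), hw2]
          exact Set.empty_subset _
      obtain ⟨xi, hxi, -, hx⟩ := hp.reflect (Hered.nice ha).1.isSuccLimit hpsi.def.not A w
        (by rwa [restr_eq_self hw])
      refine hx ((hpsi' _ _ _ _).1 hxi.1.1.2.2 _ (fun i _ => restr_sub _ _ i) fun i => ?_)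
      rw [restr, hw2, Set.empty_inter]
    obtain ⟨xi, hxi, hxi'⟩ := h D (fun _ hx => hx.2.1) hD hclo
    exact ⟨xi, ⟨hxi, hxi'.2.1⟩, hxi'.2.2⟩

section Decomposition

variable {m : ℕ} {X : Set Ordinal.{0}} {kappa : Ordinal.{0}}

theorem InPos.mem_hered (h : InPos m kappa (Set.Iio kappa)) (hreg : RegUncountable kappa) {i : ℕ}
    (hi : i ≤ m + 2) : kappa ∈ Hered i := by
  have hn := h.nice hreg
  induction i with
  | zero => exact hn
  | succ i ih =>
    refine ⟨ih (by omega), PiIndesc.of_le (n := m + 1) ?_ (by omega)⟩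
    have hu : Set.Iio kappa ⊆ {b | b < kappa ∧ b ∉ Hered i} ∪ (Hered i ∩ Set.Iio kappa) :=
      fun b hb => by
        by_cases hbi : b ∈ Hered i
        · exact Or.inr ⟨hbi, hb⟩
        · exact Or.inl ⟨hb, hbi⟩
    have := (h.mono hu (by rintro b (hb | hb); exacts [hb.1, hb.2])).or_of_union hreg
    exact (this.resolve_left fun h' =>
      isSubtleIn_diff_hered hn i (h'.isSubtleIn hreg)).piIndesc hreg

/-- The ordinals of `X` below `b` at which the list `L` agrees with `P`. -/
def agreeSet (X : Set Ordinal.{0}) (L : Ordinal.{0} → Set Ordinal.{0}) (P : Set Ordinal.{0}) :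
    Set Ordinal.{0} := {a | a ∈ X ∧ L a = P ∩ Set.Iio a}

theorem homog_agreeSet {L : Ordinal.{0} → Set Ordinal.{0}} {P : Set Ordinal.{0}} :
    Homog L (agreeSet X L P) := by
  intro a ha b hb hab
  rw [ha.2, hb.2, Set.inter_assoc, Set.inter_eq_right.2 (Set.Iio_subset_Iio hab.le)]

theorem not_isSubtleIn_of_not_stat (hn : Nice kappa) {L : Ordinal.{0} → Set Ordinal.{0}}
    (hL : ∀ a ∈ X, L a ⊆ Set.Iio a) :
    ¬ IsSubtleIn {b | b ∈ X ∧ b ∈ Hered m ∧ ¬ Stat m (agreeSet X L (L b) ∩ Set.Iio b) b} kappa := by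
  intro hS
  cases m with
  | zero =>
    have hex : ∀ b, ∃ g, ¬ Stat 0 (agreeSet X L (L b) ∩ Set.Iio b) b → g < b ∧
        ∀ d ∈ agreeSet X L (L b) ∩ Set.Iio b, d ≤ g := by
      intro b
      by_contra! hcon
      refine (hcon 0).1 fun g hg => ?_
      obtain ⟨d, hd, hgd⟩ := (hcon g).2 hg
      exact ⟨d, hd, hgd, hd.2⟩
    choose g hg using hex
    let B : Ordinal.{0} → ℕ → List ZFSet.{0} → Prop := fun b i => match i with
      | 0 => ordCode (L b)
      | _ => ordCode {g b}
    obtain ⟨a, ⟨ha, -⟩, b, ⟨hb, -⟩, hab, hag⟩ :=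
      hS.exists_agree hn B (isClubIn_Iio hn.1.isSuccLimit)
    have hga := (hg a ha.2.2).1
    have heq : g a ∈ ({g b} : Set Ordinal.{0}) ∩ Set.Iio a :=
      hag.eq_inter (i := 1) (D := {g a}) rfl rfl (by simpa using hga) ▸ rfl
    have hab' := (hg b hb.2.2).2 a
      ⟨⟨ha.1, hag.eq_inter (i := 0) rfl rfl (hL a ha.1)⟩, hab⟩
    rw [← (heq.1 : g a = g b)] at hab'
    exact hab'.not_gt hga
  | succ m =>
    have hex : ∀ b, ∃ D, ¬ Stat (m + 1) (agreeSet X L (L b) ∩ Set.Iio b) b → D ⊆ Set.Iio b ∧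
        Stat m D b ∧ ReflClosed (Hered m) (Stat m) D b ∧
        ¬ (agreeSet X L (L b) ∩ Set.Iio b ∩ D).Nonempty := by
      intro b
      by_contra! hcon
      exact (hcon ∅).1 fun D hD h1 h2 => (hcon D).2 hD h1 h2
    choose D hD using hex
    let B : Ordinal.{0} → ℕ → List ZFSet.{0} → Prop := fun b i => match i with
      | 0 => ordCode (L b)
      | _ => ordCode (D b)
    obtain ⟨a, ⟨ha, -⟩, b, ⟨hb, -⟩, hab, hag⟩ :=
      hS.exists_agree hn B (isClubIn_Iio hn.1.isSuccLimit)
    have hLa := hag.eq_inter (i := 0) rfl rfl (hL a ha.1)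
    have hDa := hag.eq_inter (i := 1) rfl rfl (hD a ha.2.2).1
    have haD := (hD b hb.2.2).2.2.1 a ha.2.1.1 hab (hDa ▸ (hD a ha.2.2).2.1)
    exact (hD b hb.2.2).2.2.2 ⟨a, ⟨⟨ha.1, hLa⟩, hab⟩, haD⟩

theorem not_piIndesc_of_stat (hk : kappa ∈ Hered m) {L : Ordinal.{0} → Set Ordinal.{0}}
    (hL : ∀ a ∈ X, L a ⊆ Set.Iio a) (hbad : ∀ H ⊆ X, Homog L H → ¬ PosN m H kappa) :
    ¬ PiIndesc (m + 1) {b | b ∈ X ∧ Stat m (agreeSet X L (L b) ∩ Set.Iio b) b} kappa := by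
  intro hind
  have hlim := (Hered.nice hk).1.isSuccLimit
  obtain ⟨R, hR, hR'⟩ := exists_piDef_stat m
  let is : SOForm := .fall (.iff (.app 0 0) (lookF 2 1 0))
  have his : is.FO := by simp [is, FO_lookF]
  have hdef :=
    (PiDef.up ((hR.ren (fun i => if i = 0 then 0 else i + 2)).and his.piDef).not).sall.sall
  let w : ℕ → Set ZFSet.{0} := consVal (encClass fun a D => a ∈ X ∧ L a = D) statParam
  have hw : ∀ b, Order.IsSuccLimit b → ∀ A v, ∀ P ⊆ Vrank b, ∀ Q ⊆ Vrank b,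
      ((R (Vrank b) A v (fun i => consVal Q (consVal P (restr w (Vrank b)))
          (if i = 0 then 0 else i + 2)) ∧
        SOSat (Vrank b) A is v (consVal Q (consVal P (restr w (Vrank b))))) ↔
      Stat m (pre Q) b ∧ Q = Ordinal.toZFSet '' (agreeSet X L (pre P) ∩ Set.Iio b)) := by
    intro b hb A v P hP Q hQ
    refine and_congr (hR' b hb A v _ (isStatParam_restr b)) ?_
    have ht : consVal Q (consVal P (restr w (Vrank b))) 2 =
      encClass (fun a D => a ∈ X ∧ L a = D) ∩ Vrank b := rfl
    simp only [is, sat_fall, sat_iff, sat_app, sat_lookF hb ht, consVal_zero, consVal_one]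
    constructor
    · intro h
      ext x
      constructor
      · intro hx
        obtain ⟨a, hab, rfl, ha⟩ := (h x (hQ hx)).1 hx
        exact ⟨a, ⟨ha, hab⟩, rfl⟩
      · rintro ⟨a, ⟨ha, hab⟩, rfl⟩
        exact (h _ (toZFSet_mem_Vrank.2 hab)).2 ⟨a, hab, rfl, ha⟩
    · rintro rfl x -
      constructor
      · rintro ⟨a, ⟨ha, hab⟩, rfl⟩
        exact ⟨a, hab, rfl, ha⟩
      · rintro ⟨a, hab, rfl, ha⟩
        exact ⟨a, ⟨ha, hab⟩, rfl⟩
  obtain ⟨b, ⟨hbX, hb⟩, hbl, hrefl⟩ := hind.reflect hlim hdef ∅ w fun P hP Q hQ h => by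
    obtain ⟨hst, rfl⟩ := (hw kappa hlim _ _ P hP Q hQ).1 h
    rw [pre_image] at hst
    have hpos := hst.posN hk
    refine hbad _ (fun a ha => ha.1.1.1) ?_ hpos
    exact fun a ha b hb => homog_agreeSet a ha.1.1 b hb.1.1
  have hLb := hL b hbX
  refine hrefl _ (image_subset_Vrank hLb) _
    (image_subset_Vrank (D := agreeSet X L (L b) ∩ Set.Iio b) Set.inter_subset_right)
    ((hw b hbl _ _ _ (image_subset_Vrank hLb) _
      (image_subset_Vrank Set.inter_subset_right)).2 ⟨?_, ?_⟩)
  · rwa [pre_image]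
  · rw [pre_image]

theorem exists_union_of_not_inPos (hk : kappa ∈ Hered m) (hX : X ⊆ Set.Iio kappa)
    (h : ¬ InPos m kappa X) : ∃ A B, A ⊆ Set.Iio kappa ∧ ¬ IsSubtleIn A kappa ∧
      B ⊆ Set.Iio kappa ∧ ¬ PiIndesc (m + 1) B kappa ∧ X = A ∪ B := by
  obtain ⟨L, hL, hbad⟩ := InPos.exists_list h hX
  have hn := Hered.nice hk
  let N : Set Ordinal.{0} := X ∩ {b | b < kappa ∧ b ∉ Hered m}
  let A : Set Ordinal.{0} :=
    {b | b ∈ X ∧ b ∈ Hered m ∧ ¬ Stat m (agreeSet X L (L b) ∩ Set.Iio b) b}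
  let B : Set Ordinal.{0} := {b | b ∈ X ∧ Stat m (agreeSet X L (L b) ∩ Set.Iio b) b}
  refine ⟨N ∪ A, B, ?_, fun hs => ?_, fun b hb => hX hb.1, not_piIndesc_of_stat hk hL hbad, ?_⟩
  · rintro b (hb | hb)
    exacts [hX hb.1, hX hb.1]
  · rcases hs.or_of_union hn with h' | h'
    · exact isSubtleIn_diff_hered hn m (h'.mono Set.inter_subset_right fun b hb => hb.1)
    · exact not_isSubtleIn_of_not_stat hn hL h'
  · ext b
    simp only [N, A, B, Set.mem_union, Set.mem_inter_iff, Set.mem_ofPred_eq]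
    constructor
    · intro hb
      have := hX hb
      simp only [Set.mem_Iio] at this
      tauto
    · rintro ((h | h) | h) <;> exact h.1

end Decomposition

/-! ### The ideal of the ineffability operator -/

section Ideals

variable {m : ℕ} {X : Set Ordinal.{0}} {kappa : Ordinal.{0}}

theorem piPos_sub_one_iff (hreg : RegUncountable kappa) :
    PiPos ((m : ℤ) - 1) X kappa ↔ PosN m X kappa := by
  cases m with
  | zero => exact and_congr_right fun hX => mk_eq_iff_unbddIn hreg hX
  | succ m =>
    rw [Nat.cast_succ, add_sub_cancel_right]
    exact Iff.rfl

theorem piPos_add_one_iff : PiPos ((m : ℤ) - 1 + 2) X kappa ↔ PiIndesc (m + 1) X kappa := by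
  rw [show (m : ℤ) - 1 + 2 = ((m + 1 : ℕ) : ℤ) by push_cast; ring]
  exact Iff.rfl

theorem ineffPos_iff_inPos (hreg : RegUncountable kappa) :
    IneffPos kappa (fun H => PiPos ((m : ℤ) - 1) H kappa) X ↔ InPos m kappa X := by
  simp only [InPos, piPos_sub_one_iff hreg]

theorem mem_ineffIdeal_iff (hreg : RegUncountable kappa) :
    X ∈ IneffIdeal ((m : ℤ) - 1) kappa ↔ X ⊆ Set.Iio kappa ∧ ¬ InPos m kappa X := by
  rw [IneffIdeal, Set.mem_ofPred_eq, ineffPos_iff_inPos hreg]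

theorem isNormalIdealOn_ineffIdeal (hreg : RegUncountable kappa) :
    IsNormalIdealOn kappa (IneffIdeal ((m : ℤ) - 1) kappa) := by
  simp only [IsNormalIdealOn, IsIdealOn, mem_ineffIdeal_iff hreg]
  refine ⟨⟨fun X hX => hX.1, ⟨Set.empty_subset _, fun h => ?_⟩, ?_, ?_⟩, fun X hX => ?_⟩
  · obtain ⟨H, hH, hpos, -⟩ := h.2 (fun _ => ∅) fun _ _ => Set.empty_subset _
    exact (hpos.nonempty hreg.pos).ne_empty (Set.subset_empty_iff.1 hH)
  · exact fun X hX Y hY => ⟨hY.trans hX.1, fun h => hX.2 (h.mono hY hX.1)⟩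
  · exact fun X hX Y hY =>
      ⟨Set.union_subset hX.1 hY.1, fun h => (h.or_of_union hreg).elim hX.2 hY.2⟩
  · refine ⟨fun b hb => hb.1, fun h => ?_⟩
    obtain ⟨a, ha, hpos⟩ := h.of_diagUnion hreg fun a ha => (hX a ha).1
    exact (hX a ha).2 hpos

theorem InPos.ineffIdeal_eq (h : InPos m kappa (Set.Iio kappa)) (hreg : RegUncountable kappa) :
    IneffIdeal ((m : ℤ) - 1) kappa =
      genIdeal (NSub kappa) (PiIdealZ ((m : ℤ) - 1 + 2) kappa) := by
  ext X
  simp only [mem_ineffIdeal_iff hreg, genIdeal, NSub, PiIdealZ, Set.mem_ofPred_eq,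
    piPos_add_one_iff]
  constructor
  · rintro ⟨hX, hX'⟩
    obtain ⟨A, B, hA, hA', hB, hB', rfl⟩ :=
      exists_union_of_not_inPos (h.mem_hered hreg (by omega)) hX hX'
    exact ⟨A, ⟨hA, hA'⟩, B, ⟨hB, hB'⟩, rfl⟩
  · rintro ⟨A, ⟨hA, hA'⟩, B, ⟨hB, hB'⟩, rfl⟩
    exact ⟨Set.union_subset hA hB, fun hX => (hX.or_of_union hreg).elim
      (fun h' => hA' (h'.isSubtleIn hreg)) fun h' => hB' (h'.piIndesc hreg)⟩

end Ideals

/-- Baumgartner. For `n ∈ {-1} ∪ ω`, `κ ∉ 𝓘(Π¹ₙ(κ))` iff `κ` is subtle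
and `Π¹_{n+2}`-indescribable, the ideal generated by `NSub_κ ∪ Π¹_{n+2}(κ)` is a nontrivial
normal ideal, and `𝓘(Π¹ₙ(κ))` equals that generated ideal. -/
theorem ineffIdeal_eq_genIdeal (n : ℤ) (hn : -1 ≤ n)
    (kappa : Ordinal.{0}) (hreg : RegUncountable kappa) :
    IneffPos kappa (fun H => PiPos n H kappa) (Set.Iio kappa) ↔
      (IsSubtleIn (Set.Iio kappa) kappa ∧
       PiPos (n + 2) (Set.Iio kappa) kappa ∧
       Set.Iio kappa ∉ genIdeal (NSub kappa) (PiIdealZ (n + 2) kappa) ∧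
       IsNormalIdealOn kappa (genIdeal (NSub kappa) (PiIdealZ (n + 2) kappa)) ∧
       IneffIdeal n kappa = genIdeal (NSub kappa) (PiIdealZ (n + 2) kappa)) := by
  obtain ⟨m, rfl⟩ : ∃ m : ℕ, n = (m : ℤ) - 1 := ⟨(n + 1).toNat, by omega⟩
  constructor
  · intro h
    have h' := (ineffPos_iff_inPos hreg).1 h
    have heq := h'.ineffIdeal_eq hreg
    refine ⟨h'.isSubtleIn hreg, piPos_add_one_iff.2 (h'.piIndesc hreg), ?_, ?_, heq⟩
    · rw [← heq]
      exact fun hmem => hmem.2 h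
    · rw [← heq]
      exact isNormalIdealOn_ineffIdeal hreg
  · rintro ⟨-, -, hmem, -, heq⟩
    by_contra h
    rw [← heq] at hmem
    exact hmem ⟨subset_rfl, h⟩

end LCI
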